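/- arXiv:1906.07961 — 12 statements merged into one kernel-verified Lean document; each statement's English description precedes it below -/
import Mathlib

section
/- Let f : ℝⁿ → ℝⁿ be a continuous vector field with f(0) = 0, and suppose there exists a continuously differentiable function V : ℝⁿ → ℝ such that (i) V is radially unbounded (V(x) → ∞ as ‖x‖ → ∞), (ii) V(0) = 0 and V(x) > 0 for all x ≠ 0, and (iii) ⟨∇V(x), f(x)⟩ < 0 for all x ≠ 0. Then the origin is globally asymptotically stable: (stability) for every ε > 0 there exists δ > 0 such that every solution x(·) of ẋ = f(x) with ‖x(0)‖ < δ satisfies ‖x(t)‖ < ε for all t ≥ 0; and (global attractivity) every solution x(·) of ẋ = f(x) satisfies x(t) → 0 as t → ∞. -/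
open Filter MeasureTheory RealInnerProductSpace

/-- A continuous, positive definite function tending to infinity at infinity has sublevel sets
contained in arbitrarily small balls around the origin. -/
theorem exists_pos_forall_lt_imp_norm_lt {E : Type*} [NormedAddCommGroup E] [ProperSpace E]
    {V : E → ℝ} (hV : Continuous V) (hrad : Tendsto V (Bornology.cobounded E) atTop)
    (hpos : ∀ x, x ≠ 0 → 0 < V x) {ε : ℝ} (hε : 0 < ε) :
    ∃ c > 0, ∀ y, V y < c → ‖y‖ < ε := by
  rcases Set.eq_empty_or_nonempty {y : E | ε ≤ ‖y‖} with hs | ⟨y₀, hy₀⟩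
  · refine ⟨1, one_pos, fun y _ => ?_⟩
    by_contra! hy
    exact (Set.mem_empty_iff_false y).1 (hs ▸ hy)
  · have hclosed : IsClosed {y : E | ε ≤ ‖y‖} := isClosed_le continuous_const continuous_norm
    have hlarge : ∀ᶠ y in cocompact E ⊓ Filter.principal {y : E | ε ≤ ‖y‖}, V y₀ ≤ V y := by
      rw [← Metric.cobounded_eq_cocompact]
      exact (hrad.eventually_ge_atTop (V y₀)).filter_mono inf_le_left
    obtain ⟨z, hz, hmin⟩ := hV.continuousOn.exists_isMinOn' hclosed hy₀ hlarge
    have hz0 : z ≠ 0 := norm_pos_iff.1 (hε.trans_le hz)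
    refine ⟨V z, hpos z hz0, fun y hy => ?_⟩
    by_contra! h
    exact (hmin h).not_gt hy

/-- Sublevel sets of a continuous function tending to infinity at infinity are compact. -/
theorem isCompact_setOf_le_of_tendsto_cobounded {E : Type*} [PseudoMetricSpace E] [ProperSpace E]
    {V : E → ℝ} (hV : Continuous V) (hrad : Tendsto V (Bornology.cobounded E) atTop) (M : ℝ) :
    IsCompact {y | V y ≤ M} := by
  refine Metric.isCompact_of_isClosed_isBounded (isClosed_le hV continuous_const) ?_
  rw [← Bornology.isCobounded_compl_iff, Bornology.isCobounded_def]
  filter_upwards [hrad.eventually_gt_atTop M] with y hy using not_le.2 hy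

/-- A function on the half-line `[0, ∞)` whose derivative is at most `C` grows at most linearly
with slope `C`. -/
theorem le_add_mul_of_hasDerivAt_le {u u' : ℝ → ℝ} {C : ℝ}
    (hu : ∀ t, 0 ≤ t → HasDerivAt u (u' t) t) (hC : ∀ t, 0 ≤ t → u' t ≤ C)
    {s t : ℝ} (hs : 0 ≤ s) (hst : s ≤ t) : u t ≤ u s + C * (t - s) := by
  have h := (convex_Ici (0 : ℝ)).image_sub_le_mul_sub_of_deriv_le
    (fun r hr => (hu r hr).continuousAt.continuousWithinAt)
    (fun r hr => (hu r (interior_subset hr)).differentiableAt.differentiableWithinAt)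
    (fun r hr => (hu r (interior_subset hr)).deriv.trans_le (hC r (interior_subset hr)))
    s hs t (hs.trans hst) hst
  linarith

/-- The derivative of a function along a solution of `ẋ = f(x)`. -/
theorem HasDerivAt.comp_inner_gradient {E : Type*} [NormedAddCommGroup E] [InnerProductSpace ℝ E]
    [CompleteSpace E] {V : E → ℝ} {x : ℝ → E} {v : E} {t : ℝ}
    (hV : DifferentiableAt ℝ V (x t)) (hx : HasDerivAt x v t) :
    HasDerivAt (fun s => V (x s)) ⟪gradient V (x t), v⟫ t := by
  simpa [Function.comp_def] using hV.hasGradientAt.hasFDerivAt.comp_hasDerivAt t hx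

/-- **Lyapunov's theorem for global asymptotic stability.** -/
theorem lyapunov_global_asymptotic_stability
    (n : ℕ) (f : EuclideanSpace ℝ (Fin n) → EuclideanSpace ℝ (Fin n))
    (hf : Continuous f) (hf0 : f 0 = 0)
    (V : EuclideanSpace ℝ (Fin n) → ℝ) (hV : ContDiff ℝ 1 V)
    (hrad : Tendsto V (Filter.comap (fun x => ‖x‖) atTop) atTop)
    (hV0 : V 0 = 0) (hVpos : ∀ x : EuclideanSpace ℝ (Fin n), x ≠ 0 → 0 < V x)
    (hdec : ∀ x : EuclideanSpace ℝ (Fin n), x ≠ 0 → ⟪gradient V x, f x⟫ < 0) :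
    (∀ ε > (0:ℝ), ∃ δ > (0:ℝ), ∀ x : ℝ → EuclideanSpace ℝ (Fin n),
        (∀ t : ℝ, 0 ≤ t → HasDerivAt x (f (x t)) t) →
        ‖x 0‖ < δ → ∀ t : ℝ, 0 ≤ t → ‖x t‖ < ε) ∧
    (∀ x : ℝ → EuclideanSpace ℝ (Fin n),
        (∀ t : ℝ, 0 ≤ t → HasDerivAt x (f (x t)) t) →
        Tendsto x atTop (nhds 0)) := by
  have hrad' : Tendsto V (Bornology.cobounded _) atTop := by rwa [← comap_norm_atTop]
  have hnonpos : ∀ y, ⟪gradient V y, f y⟫ ≤ 0 := by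
    intro y
    rcases eq_or_ne y 0 with rfl | hy
    · simp [hf0]
    · exact (hdec y hy).le
  have hderiv : ∀ x : ℝ → EuclideanSpace ℝ (Fin n),
      (∀ t : ℝ, 0 ≤ t → HasDerivAt x (f (x t)) t) → ∀ t : ℝ, 0 ≤ t →
      HasDerivAt (fun s => V (x s)) ⟪gradient V (x t), f (x t)⟫ t := fun x hx t ht =>
    HasDerivAt.comp_inner_gradient (hV.differentiable one_ne_zero _) (hx t ht)
  have hanti : ∀ x : ℝ → EuclideanSpace ℝ (Fin n),
      (∀ t : ℝ, 0 ≤ t → HasDerivAt x (f (x t)) t) →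
      ∀ s t : ℝ, 0 ≤ s → s ≤ t → V (x t) ≤ V (x s) := fun x hx s t hs hst => by
    simpa using le_add_mul_of_hasDerivAt_le (hderiv x hx) (fun r _ => hnonpos (x r)) hs hst
  constructor
  · intro ε hε
    obtain ⟨c, hc, hball⟩ := exists_pos_forall_lt_imp_norm_lt hV.continuous hrad' hVpos hε
    have hnear : ∀ᶠ y in nhds 0, V y < c :=
      hV.continuous.continuousAt.eventually_lt_const (by rwa [hV0])
    obtain ⟨δ, hδ, hsmall⟩ := Metric.eventually_nhds_iff.1 hnear
    refine ⟨δ, hδ, fun x hx hx0 t ht => hball _ ?_⟩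
    exact (hanti x hx 0 t le_rfl ht).trans_lt (hsmall (by simpa using hx0))
  · intro x hx
    have hreach : ∀ c > 0, ∃ T, 0 ≤ T ∧ V (x T) < c := by
      intro c hc
      by_contra! hge
      have hcompact : IsCompact ({y | V y ≤ V (x 0)} ∩ {y | c ≤ V y}) :=
        (isCompact_setOf_le_of_tendsto_cobounded hV.continuous hrad' _).inter_right
          (isClosed_le continuous_const hV.continuous)
      have hgrad : Continuous (gradient V) :=
        (InnerProductSpace.toDual ℝ _).symm.continuous.comp (hV.continuous_fderiv one_ne_zero)
      have hmem : ∀ t, 0 ≤ t → x t ∈ {y | V y ≤ V (x 0)} ∩ {y | c ≤ V y} :=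
        fun t ht => ⟨hanti x hx 0 t le_rfl ht, hge t ht⟩
      obtain ⟨z, hz, hmax⟩ := hcompact.exists_isMaxOn ⟨_, hmem 0 le_rfl⟩
        (hgrad.inner (𝕜 := ℝ) hf).continuousOn
      have hz0 : z ≠ 0 := by
        rintro rfl
        exact (hV0 ▸ hz.2 : c ≤ 0).not_gt hc
      set m := ⟪gradient V z, f z⟫
      have hm : m < 0 := hdec z hz0
      have hT : 0 ≤ V (x 0) / -m :=
        div_nonneg (hc.le.trans (hge 0 le_rfl)) (neg_nonneg.2 hm.le)
      have hle := le_add_mul_of_hasDerivAt_le (hderiv x hx) (fun r hr => hmax (hmem r hr))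
        le_rfl hT
      have hcancel : m * (V (x 0) / -m - 0) = -V (x 0) := by
        field_simp [hm.ne]
        ring
      have := hge _ hT
      linarith
    refine Metric.tendsto_atTop.2 fun ε hε => ?_
    obtain ⟨c, hc, hball⟩ := exists_pos_forall_lt_imp_norm_lt hV.continuous hrad' hVpos hε
    obtain ⟨T, hT, hVT⟩ := hreach c hc
    refine ⟨T, fun t ht => ?_⟩
    rw [dist_zero_right]
    exact hball _ ((hanti x hx T t hT ht).trans_lt hVT)
end

section
/- Consider the planar polynomial vector field f(x,y) = (−x + xy, −y). The origin is a globally asymptotically stable equilibrium point for the system (ẋ, ẏ) = f(x,y), yet the system admits no polynomial Lyapunov function: there is no polynomial V ∈ ℝ[x,y] that is radially unbounded, positive definite, and satisfies ∂V/∂x·(−x+xy) + ∂V/∂y·(−y) < 0 for all (x,y) ≠ (0,0). -/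
open Filter MeasureTheory MvPolynomial

/-- The planar vector field `f(x,y) = (−x + xy, −y)`. -/
noncomputable def ahmadiField : EuclideanSpace ℝ (Fin 2) → EuclideanSpace ℝ (Fin 2) :=
  fun z => (WithLp.equiv 2 (Fin 2 → ℝ)).symm ![-(z 0) + z 0 * z 1, -(z 1)]

/-- The chain rule for a multivariate polynomial along a differentiable curve. -/
theorem MvPolynomial.hasDerivAt_eval_curve {σ : Type*} [Fintype σ] (P : MvPolynomial σ ℝ)
    {c : ℝ → σ → ℝ} {c' : σ → ℝ} {t : ℝ} (hc : ∀ i, HasDerivAt (fun s => c s i) (c' i) t) :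
    HasDerivAt (fun s => eval (c s) P) (∑ i, eval (c t) (pderiv i P) * c' i) t := by
  classical
  induction P using MvPolynomial.induction_on with
  | C a => simpa using hasDerivAt_const t a
  | add p q hp hq =>
    simpa [add_mul, Finset.sum_add_distrib] using hp.fun_add hq
  | mul_X p j hp =>
    simp only [map_mul, eval_X]
    refine (hp.fun_mul (hc j)).congr_deriv ?_
    simp [pderiv_X, Pi.single_apply, add_mul, Finset.sum_add_distrib, Finset.sum_mul,
      apply_ite (eval (c t)), ite_mul, mul_ite]
    rw [add_comm]
    congr 1
    exact Finset.sum_congr rfl fun i _ => by ring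

theorem MvPolynomial.polynomial_eval_aeval {σ : Type*} (P : MvPolynomial σ ℝ)
    (f : σ → Polynomial ℝ) (s : ℝ) :
    (aeval f P).eval s = eval (fun i => (f i).eval s) P := by
  induction P using MvPolynomial.induction_on with
  | C a => simp
  | add p q hp hq => simp [hp, hq]
  | mul_X p j hp => simp [hp]

/-- A function with vanishing derivative on `[0, ∞)` stays equal to its initial value. -/
theorem eq_initial_of_hasDerivAt_zero {g : ℝ → ℝ} (hg : ∀ t, 0 ≤ t → HasDerivAt g 0 t)
    {t : ℝ} (ht : 0 ≤ t) : g t = g 0 :=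
  constant_of_has_deriv_right_zero
    (fun s hs => (hg s hs.1).continuousAt.continuousWithinAt)
    (fun s hs => (hg s hs.1).hasDerivWithinAt) t ⟨ht, le_rfl⟩

theorem ahmadiField_solution_norm_le {x : ℝ → EuclideanSpace ℝ (Fin 2)}
    (hx : ∀ t : ℝ, 0 ≤ t → HasDerivAt x (ahmadiField (x t)) t) {t : ℝ} (ht : 0 ≤ t) :
    ‖x t‖ ≤ ‖x 0‖ * (Real.exp (2 * ‖x 0‖) + 1) * Real.exp (-t) := by
  have hcoord (s : ℝ) (hs : 0 ≤ s) (i : Fin 2) :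
      HasDerivAt (fun s => x s i) (ahmadiField (x s) i) s :=
    (EuclideanSpace.proj (𝕜 := ℝ) i).hasFDerivAt.comp_hasDerivAt s (hx s hs)
  have h0 (s : ℝ) (hs : 0 ≤ s) : HasDerivAt (fun s => x s 0) (-(x s 0) + x s 0 * x s 1) s := by
    simpa [ahmadiField] using hcoord s hs 0
  have h1 (s : ℝ) (hs : 0 ≤ s) : HasDerivAt (fun s => x s 1) (-(x s 1)) s := by
    simpa [ahmadiField] using hcoord s hs 1
  have e1 : x t 1 * Real.exp t = x 0 1 := by
    have := eq_initial_of_hasDerivAt_zero (g := fun s => x s 1 * Real.exp s)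
      (fun s hs => ((h1 s hs).fun_mul (Real.hasDerivAt_exp s)).congr_deriv (by ring)) ht
    simpa using this
  have e0 : x t 0 * Real.exp (t + x t 1) = x 0 0 * Real.exp (x 0 1) := by
    have := eq_initial_of_hasDerivAt_zero (g := fun s => x s 0 * Real.exp (s + x s 1))
      (fun s hs => ((h0 s hs).fun_mul ((hasDerivAt_id' s).fun_add (h1 s hs)).exp).congr_deriv
        (by ring)) ht
    simpa using this
  have f1 : x t 1 = x 0 1 * Real.exp (-t) := by
    rw [← e1, mul_assoc, ← Real.exp_add]; simp
  have f0 : x t 0 = x 0 0 * Real.exp (x 0 1 - x t 1) * Real.exp (-t) := by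
    rw [sub_eq_add_neg, Real.exp_add, ← mul_assoc, ← e0, mul_assoc, mul_assoc, ← Real.exp_add,
      ← Real.exp_add]
    simp
  have hn (i : Fin 2) : |x 0 i| ≤ ‖x 0‖ := PiLp.norm_apply_le (x 0) i
  have hexp : Real.exp (-t) ≤ 1 := Real.exp_le_one_iff.mpr (by linarith)
  have hy : |x t 1| ≤ ‖x 0‖ := by
    rw [f1, abs_mul, Real.abs_exp]
    exact (mul_le_of_le_one_right (abs_nonneg _) hexp).trans (hn 1)
  have hnorm : ‖x t‖ ≤ |x t 0| + |x t 1| := by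
    rw [EuclideanSpace.norm_eq, Fin.sum_univ_two]
    refine Real.sqrt_le_iff.mpr ⟨by positivity, ?_⟩
    simp only [Real.norm_eq_abs]
    nlinarith [abs_nonneg (x t 0), abs_nonneg (x t 1)]
  have hE : Real.exp (x 0 1 - x t 1) ≤ Real.exp (2 * ‖x 0‖) :=
    Real.exp_le_exp.mpr (by linarith [le_abs_self (x 0 1), neg_abs_le (x t 1), hn 1])
  calc ‖x t‖ ≤ |x t 0| + |x t 1| := hnorm
    _ = |x 0 0| * Real.exp (x 0 1 - x t 1) * Real.exp (-t) + |x 0 1| * Real.exp (-t) := by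
      rw [congrArg abs f0, congrArg abs f1]
      simp only [abs_mul, Real.abs_exp]
    _ ≤ ‖x 0‖ * Real.exp (2 * ‖x 0‖) * Real.exp (-t) + ‖x 0‖ * Real.exp (-t) := by
      gcongr
      · exact hn 0
      · exact hn 1
    _ = _ := by ring

/-- A polynomial which strictly decreases along `ahmadiField` away from the origin does not
decrease along the reversed orbit arc joining `(exp (k - 1), 1)` to `(k, k)`. -/
theorem eval_exp_le_eval_diagonal {P : MvPolynomial (Fin 2) ℝ}
    (hP : ∀ z : EuclideanSpace ℝ (Fin 2), z ≠ 0 →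
      eval (fun i => z i) (pderiv 0 P) * (-(z 0) + z 0 * z 1)
        + eval (fun i => z i) (pderiv 1 P) * (-(z 1)) < 0) {k : ℝ} (hk : 1 ≤ k) :
    eval ![Real.exp (k - 1), 1] P ≤ eval ![k, k] P := by
  set c : ℝ → Fin 2 → ℝ := fun y => ![y * Real.exp (k - y), y]
  set c' : ℝ → Fin 2 → ℝ := fun y => ![Real.exp (k - y) - y * Real.exp (k - y), 1]
  have hc (y : ℝ) (i : Fin 2) : HasDerivAt (fun s => c s i) (c' y i) y := by
    fin_cases i
    · exact ((hasDerivAt_id' y).fun_mul ((hasDerivAt_id' y).const_sub k).exp).congr_deriv (by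
        simp [c']
        ring)
    · exact hasDerivAt_id y
  have hder (y : ℝ) := P.hasDerivAt_eval_curve (hc y)
  have hmono : MonotoneOn (fun y => eval (c y) P) (Set.Icc 1 k) := by
    refine monotoneOn_of_hasDerivWithinAt_nonneg (convex_Icc 1 k)
      (fun y _ => (hder y).continuousAt.continuousWithinAt)
      (fun y _ => (hder y).hasDerivWithinAt) fun y hy => ?_
    rw [interior_Icc] at hy
    have hy0 : 0 < y := by linarith [hy.1]
    have h := hP (WithLp.toLp 2 (c y)) fun h0 =>
      hy0.ne' (by simpa [c] using congrArg (fun z => z 1) h0)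
    rw [Fin.sum_univ_two]
    have hmul : y * (eval (c y) (pderiv 0 P) * c' y 0 + eval (c y) (pderiv 1 P) * c' y 1) =
        -(eval (c y) (pderiv 0 P) * (-(c y 0) + c y 0 * c y 1)
          + eval (c y) (pderiv 1 P) * (-(c y 1))) := by
      simp [c, c']
      ring
    have hpos : 0 ≤ y * (eval (c y) (pderiv 0 P) * c' y 0 + eval (c y) (pderiv 1 P) * c' y 1) := by
      rw [hmul]
      exact neg_nonneg.mpr h.le
    exact nonneg_of_mul_nonneg_right hpos hy0
  simpa [c] using hmono ⟨le_rfl, hk⟩ ⟨hk, le_rfl⟩ hk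

/-- A real polynomial of positive degree, composed with the exponential, is not eventually
bounded in absolute value by a polynomial. -/
theorem Polynomial.not_eventually_abs_eval_exp_le {p q : Polynomial ℝ} (hp : 0 < p.degree) :
    ¬ ∀ᶠ k : ℝ in atTop, |p.eval (Real.exp (k - 1))| ≤ |q.eval k| := by
  intro h
  have hexp : Tendsto (fun k : ℝ => Real.exp (k - 1)) atTop atTop :=
    Real.tendsto_exp_atTop.comp (tendsto_atTop_add_const_right _ _ tendsto_id)
  have h1 : (fun k : ℝ => Real.exp (k - 1)) =O[atTop] fun k => p.eval (Real.exp (k - 1)) := by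
    have : (fun s : ℝ => (Polynomial.X : Polynomial ℝ).eval s) =O[atTop] fun s => p.eval s :=
      Polynomial.isBigO_atTop_of_degree_le _ _ (by
        rw [Polynomial.degree_X]; exact (WithBot.one_le_iff_pos _).mpr hp)
    simpa [Function.comp_def] using this.comp_tendsto hexp
  have h2 : (fun k : ℝ => p.eval (Real.exp (k - 1))) =O[atTop] fun k => q.eval k :=
    Asymptotics.IsBigO.of_bound 1 (h.mono fun k hk => by simpa using hk)
  have h3 : (fun k : ℝ => q.eval k) =O[atTop] fun k => k ^ q.natDegree := by
    simpa using Polynomial.isBigO_atTop_of_degree_le q (Polynomial.X ^ q.natDegree) (by simp)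
  have h4 : (fun k : ℝ => k ^ q.natDegree) =o[atTop] Real.exp := Real.isLittleO_pow_exp_atTop
  have h5 : Real.exp =O[atTop] fun k : ℝ => Real.exp (k - 1) :=
    Asymptotics.IsBigO.of_bound (Real.exp 1) (Eventually.of_forall fun k => by
      simp [← Real.exp_add])
  have h6 := ((h1.trans (h2.trans h3)).trans_isLittleO h4).trans_isBigO h5
  exact (Asymptotics.isLittleO_irrefl
    (Eventually.of_forall fun k => (Real.exp_pos (k - 1)).ne').frequently) h6

/-- The origin is globally asymptotically stable for `(ẋ,ẏ) = (−x+xy, −y)`,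
yet no polynomial Lyapunov function exists for this system. -/
theorem no_polynomial_lyapunov_function :
    ((∀ ε > (0:ℝ), ∃ δ > (0:ℝ), ∀ x : ℝ → EuclideanSpace ℝ (Fin 2),
        (∀ t : ℝ, 0 ≤ t → HasDerivAt x (ahmadiField (x t)) t) →
        ‖x 0‖ < δ → ∀ t : ℝ, 0 ≤ t → ‖x t‖ < ε) ∧
     (∀ x : ℝ → EuclideanSpace ℝ (Fin 2),
        (∀ t : ℝ, 0 ≤ t → HasDerivAt x (ahmadiField (x t)) t) →
        Tendsto x atTop (nhds 0))) ∧
    ¬ ∃ P : MvPolynomial (Fin 2) ℝ,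
        Tendsto (fun z : EuclideanSpace ℝ (Fin 2) => eval (fun i => z i) P)
          (Filter.comap (fun z : EuclideanSpace ℝ (Fin 2) => ‖z‖) atTop) atTop ∧
        eval (fun _ => (0:ℝ)) P = 0 ∧
        (∀ z : EuclideanSpace ℝ (Fin 2), z ≠ 0 → 0 < eval (fun i => z i) P) ∧
        (∀ z : EuclideanSpace ℝ (Fin 2), z ≠ 0 →
          eval (fun i => z i) (pderiv 0 P) * (-(z 0) + z 0 * z 1)
            + eval (fun i => z i) (pderiv 1 P) * (-(z 1)) < 0) := by
  refine ⟨⟨fun ε hε => ?_, fun x hx => ?_⟩, ?_⟩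
  · have hC : 0 < Real.exp 2 + 1 := by positivity
    refine ⟨min 1 (ε / (Real.exp 2 + 1)), by positivity, fun x hx h t ht => ?_⟩
    obtain ⟨hlt1, hltε⟩ := lt_min_iff.mp h
    calc ‖x t‖ ≤ ‖x 0‖ * (Real.exp (2 * ‖x 0‖) + 1) * Real.exp (-t) :=
          ahmadiField_solution_norm_le hx ht
      _ ≤ ‖x 0‖ * (Real.exp (2 * ‖x 0‖) + 1) :=
          mul_le_of_le_one_right (by positivity) (Real.exp_le_one_iff.mpr (by linarith))
      _ ≤ ‖x 0‖ * (Real.exp 2 + 1) := by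
          gcongr
          linarith
      _ < ε := (lt_div_iff₀ hC).mp hltε
  · refine squeeze_zero_norm' ((eventually_ge_atTop 0).mono fun t ht =>
      ahmadiField_solution_norm_le hx ht) ?_
    simpa using Real.tendsto_exp_neg_atTop_nhds_zero.const_mul
      (‖x 0‖ * (Real.exp (2 * ‖x 0‖) + 1))
  · rintro ⟨P, hunb, -, hpos, hdec⟩
    set p : Polynomial ℝ := aeval ![Polynomial.X, 1] P
    set q : Polynomial ℝ := aeval ![Polynomial.X, Polynomial.X] P
    have hp (s : ℝ) : p.eval s = eval ![s, 1] P := by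
      rw [polynomial_eval_aeval]
      congr 2
      ext i; fin_cases i <;> simp
    have hq (s : ℝ) : q.eval s = eval ![s, s] P := by
      rw [polynomial_eval_aeval]
      congr 2
      ext i; fin_cases i <;> simp
    have hptop : Tendsto (fun s => p.eval s) atTop atTop := by
      simp only [hp]
      refine hunb.comp (f := fun s : ℝ => !₂[s, 1]) (tendsto_comap_iff.mpr ?_)
      exact tendsto_atTop_mono
        (fun s => (le_abs_self s).trans (PiLp.norm_apply_le (!₂[s, 1]) 0)) tendsto_id
    refine Polynomial.not_eventually_abs_eval_exp_le (p := p) (q := q)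
      (Polynomial.tendsto_atTop_iff_leadingCoeff_nonneg p |>.mp hptop).1
      ((eventually_ge_atTop 1).mono fun k hk => ?_)
    have hppos : 0 < eval ![Real.exp (k - 1), 1] P :=
      hpos !₂[Real.exp (k - 1), 1] fun h0 => by simpa using congrArg (fun z => z 1) h0
    rw [hp, hq, abs_of_pos hppos]
    exact (eval_exp_le_eval_diagonal hdec hk).trans (le_abs_self _)
end

section
/- Let f : ℝⁿ → ℝⁿ be continuous, and let X₀ and X_u be subsets of ℝⁿ. Suppose there exists a continuously differentiable function B : ℝⁿ → ℝ such that (i) B(x) > 0 for all x ∈ X_u, (ii) B(x) ≤ 0 for all x ∈ X₀, and (iii) ⟨∇B(x), f(x)⟩ ≤ 0 for all x ∈ ℝⁿ. Then no solution of ẋ = f(x) that starts from an initial state in X₀ ever reaches a state in X_u; that is, every solution x(·) with x(0) ∈ X₀ satisfies x(t) ∉ X_u for all t ≥ 0. -/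
open Filter RealInnerProductSpace

/-- **Barrier certificates certify collision avoidance** (Prajna–Jadbabaie). -/
theorem barrier_certificate_collision_avoidance
    (n : ℕ) (f : EuclideanSpace ℝ (Fin n) → EuclideanSpace ℝ (Fin n))
    (hf : Continuous f)
    (X₀ Xu : Set (EuclideanSpace ℝ (Fin n)))
    (B : EuclideanSpace ℝ (Fin n) → ℝ) (hB : ContDiff ℝ 1 B)
    (hBu : ∀ x ∈ Xu, 0 < B x)
    (hB0 : ∀ x ∈ X₀, B x ≤ 0)
    (hBdec : ∀ x : EuclideanSpace ℝ (Fin n), ⟪gradient B x, f x⟫ ≤ 0) :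
    ∀ x : ℝ → EuclideanSpace ℝ (Fin n),
      (∀ t : ℝ, 0 ≤ t → HasDerivAt x (f (x t)) t) →
      x 0 ∈ X₀ → ∀ t : ℝ, 0 ≤ t → x t ∉ Xu := by
  intro x hx hx0 t ht hxt
  have hderiv : ∀ s : ℝ, 0 ≤ s → HasDerivAt (B ∘ x) ⟪gradient B (x s), f (x s)⟫ s := by
    intro s hs
    have hgrad := ((hB.differentiable one_ne_zero) (x s)).hasGradientAt.hasFDerivAt
    simpa using hgrad.comp_hasDerivAt s (hx s hs)
  have hanti : AntitoneOn (B ∘ x) (Set.Ici 0) := by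
    refine antitoneOn_of_deriv_nonpos (convex_Ici 0)
      (fun s hs => (hderiv s hs).continuousAt.continuousWithinAt) ?_ ?_
    · intro s hs
      exact (hderiv s (interior_subset hs)).differentiableAt.differentiableWithinAt
    · intro s hs
      rw [(hderiv s (interior_subset hs)).deriv]
      exact hBdec (x s)
  have hle : B (x t) ≤ B (x 0) := hanti Set.self_mem_Ici ht ht
  exact absurd (hBu (x t) hxt) (hle.trans (hB0 (x 0) hx0)).not_gt
end

section
/- Fix n and d, and let N = {α ∈ ℕⁿ : |α| ≤ 2d}. Let P_{n,2d} ⊆ ℝᴺ be the cone of coefficient vectors of polynomials nonnegative on ℝⁿ, and let M_{n,2d} ⊆ ℝᴺ be the cone of vectors (y_α)_{α∈N} for which there exists a nonnegative Borel measure μ on ℝⁿ such that x ↦ x^α is μ-integrable and y_α = ∫ x^α dμ for all α ∈ N. Then the dual cone of P_{n,2d} equals the closure of M_{n,2d} in ℝᴺ. -/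
open MeasureTheory Finset

/-- Multi-indices `α ∈ ℕⁿ` with `|α| ≤ d`. -/
abbrev MultiIdx (n d : ℕ) : Type := {α : Fin n → ℕ // ∑ i, α i ≤ d}

instance (n d : ℕ) : Finite (MultiIdx n d) := by
  have hbound : ∀ a : MultiIdx n d, ∀ i, a.1 i < d + 1 := by
    intro a i
    have h1 : a.1 i ≤ ∑ j, a.1 j :=
      Finset.single_le_sum (f := a.1) (fun j _ => Nat.zero_le _) (Finset.mem_univ i)
    have h2 := a.2
    omega
  exact Finite.of_injective
    (fun a : MultiIdx n d => fun i => (⟨a.1 i, hbound a i⟩ : Fin (d + 1)))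
    (fun a b h => Subtype.ext (funext fun i => congrArg Fin.val (congrFun h i)))

noncomputable instance (n d : ℕ) : Fintype (MultiIdx n d) := Fintype.ofFinite _

/-- The cone of vectors of integrals of a finite family of functions, over all measures for which
every function in the family is integrable. -/
noncomputable def integralCone {ι X : Type*} [MeasurableSpace X] (f : ι → X → ℝ) :
    PointedCone ℝ (ι → ℝ) where
  carrier := {y | ∃ μ : Measure X, ∀ a, Integrable (f a) μ ∧ y a = ∫ x, f a x ∂μ}
  zero_mem' := ⟨0, fun a => by simp⟩
  add_mem' := by
    rintro y z ⟨μ, hμ⟩ ⟨ν, hν⟩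
    refine ⟨μ + ν, fun a => ⟨(hμ a).1.add_measure (hν a).1, ?_⟩⟩
    rw [integral_add_measure (hμ a).1 (hν a).1, Pi.add_apply, (hμ a).2, (hν a).2]
  smul_mem' := by
    rintro ⟨c, hc⟩ y ⟨μ, hμ⟩
    refine ⟨ENNReal.ofReal c • μ, fun a =>
      ⟨(hμ a).1.smul_measure ENNReal.ofReal_ne_top, ?_⟩⟩
    rw [integral_smul_measure, ENNReal.toReal_ofReal hc, ← (hμ a).2]
    rfl

/-- The point evaluations of a family of measurable functions lie in its integral cone. -/
theorem eval_mem_integralCone {ι X : Type*} [MeasurableSpace X] {f : ι → X → ℝ}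
    (hf : ∀ a, Measurable (f a)) (x : X) : (fun a => f a x) ∈ integralCone f :=
  ⟨Measure.dirac x, fun a =>
    ⟨integrable_dirac' (hf a).stronglyMeasurable enorm_lt_top,
      (integral_dirac' _ x (hf a).stronglyMeasurable).symm⟩⟩

/-- A linear combination that is nonnegative as a function pairs nonnegatively with the closure of
the integral cone. -/
theorem sum_mul_nonneg_of_mem_closure_integralCone {ι X : Type*} [Fintype ι] [MeasurableSpace X]
    {f : ι → X → ℝ} {p : ι → ℝ} (hp : ∀ x, 0 ≤ ∑ a, p a * f a x) {y : ι → ℝ}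
    (hy : y ∈ closure (integralCone f : Set (ι → ℝ))) : 0 ≤ ∑ a, p a * y a := by
  have hclosed : IsClosed {y : ι → ℝ | 0 ≤ ∑ a, p a * y a} :=
    isClosed_le continuous_const (by fun_prop)
  refine closure_minimal ?_ hclosed hy
  rintro z ⟨μ, hμ⟩
  have h : ∑ a, p a * z a = ∫ x, ∑ a, p a * f a x ∂μ := by
    rw [integral_finsetSum _ fun a _ => (hμ a).1.const_mul (p a)]
    simp only [integral_const_mul, (hμ _).2]
  exact (integral_nonneg hp).trans_eq h.symm

/-- The dual of the cone of nonnegative linear combinations of finitely many measurable functions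
is the closure of the cone of integral vectors. -/
theorem dual_nonneg_combinations_eq_closure_integralCone {ι X : Type*} [Fintype ι]
    [MeasurableSpace X] {f : ι → X → ℝ} (hf : ∀ a, Measurable (f a)) :
    {y : ι → ℝ | ∀ p ∈ {p : ι → ℝ | ∀ x, 0 ≤ ∑ a, p a * f a x}, 0 ≤ ∑ a, p a * y a}
      = closure (integralCone f : Set (ι → ℝ)) := by
  classical
  refine Set.Subset.antisymm (fun y hy => ?_) fun y hy p hp =>
    sum_mul_nonneg_of_mem_closure_integralCone hp hy
  by_contra hmem
  let C : ProperCone ℝ (ι → ℝ) := ⟨(integralCone f).closure, isClosed_closure⟩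
  obtain ⟨g, hg, hgy⟩ := C.hyperplane_separation_point (x₀ := y) hmem
  have hsum (z : ι → ℝ) : ∑ a, g (Pi.single a 1) * z a = g z := by
    conv_rhs => rw [pi_eq_sum_univ' z, map_sum]
    refine Finset.sum_congr rfl fun a _ => ?_
    rw [map_smul, smul_eq_mul, mul_comm]
  refine hgy.not_ge ?_
  rw [← hsum]
  refine hy (fun a => g (Pi.single a 1)) fun x => ?_
  rw [hsum fun a => f a x]
  exact hg _ (subset_closure (eval_mem_integralCone hf x))

/-- The dual cone of the cone `P_{n,2d}` of (coefficient vectors of) polynomials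
nonnegative on `ℝⁿ` is the closure of the cone `M_{n,2d}` of truncated moment
sequences. -/
theorem dual_cone_of_nonneg_polynomials_eq_closure_moment_cone
    (n d : ℕ)
    (P : Set (MultiIdx n (2 * d) → ℝ))
    (hP : P = {p | ∀ x : Fin n → ℝ, 0 ≤ ∑ α : MultiIdx n (2 * d), p α * ∏ i, x i ^ α.1 i})
    (M : Set (MultiIdx n (2 * d) → ℝ))
    (hM : M = {y | ∃ μ : Measure (Fin n → ℝ),
        ∀ α : MultiIdx n (2 * d),
          Integrable (fun x : Fin n → ℝ => ∏ i, x i ^ α.1 i) μ ∧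
          y α = ∫ x : Fin n → ℝ, ∏ i, x i ^ α.1 i ∂μ}) :
    {y : MultiIdx n (2 * d) → ℝ | ∀ p ∈ P, 0 ≤ ∑ α : MultiIdx n (2 * d), p α * y α}
      = closure M := by
  subst hP hM
  exact dual_nonneg_combinations_eq_closure_integralCone fun α => by fun_prop
end

section
/- Let y = (y₀, y₁, …, y_{2d}) be a sequence of real numbers with y₀ = 1, and let M_d(y) be the (d+1)×(d+1) Hankel matrix whose (i,j) entry is y_{i+j} for 0 ≤ i,j ≤ d. (a) If there exists a Borel probability measure μ on ℝ such that x ↦ x^i is μ-integrable and y_i = ∫ x^i dμ for all i = 0,…,2d, then M_d(y) is positive semidefinite. (b) Conversely, if M_d(y) is positive definite, then there exists a Borel probability measure μ on ℝ such that y_i = ∫ x^i dμ for all i = 0,…,2d. -/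
open MeasureTheory

open scoped MatrixOrder in
/-- A positive definite real matrix factors as `Bᵀ * B` with `B` invertible. -/
theorem Matrix.PosDef.exists_isUnit_eq_transpose_mul_self {n : Type*} [Fintype n] [DecidableEq n]
    {M : Matrix n n ℝ} (hM : M.PosDef) : ∃ B : Matrix n n ℝ, IsUnit B ∧ M = B.transpose * B := by
  obtain ⟨B, hB⟩ := CStarAlgebra.nonneg_iff_eq_star_mul_self.mp hM.posSemidef.nonneg
  rw [Matrix.star_eq_conjTranspose, Matrix.conjTranspose_eq_transpose_of_trivial] at hB
  have hdet := hM.det_pos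
  rw [hB, Matrix.det_mul] at hdet
  refine ⟨B, ?_, hB⟩
  rw [Matrix.isUnit_iff_isUnit_det, isUnit_iff_ne_zero]
  exact right_ne_zero_of_mul hdet.ne'

/-- The spectral moments `v ⬝ Aⁿ v` of a real symmetric matrix are the moments of a finitely
supported nonnegative weight. -/
theorem Matrix.IsHermitian.dotProduct_pow_mulVec {n : Type*} [Fintype n] [DecidableEq n]
    {A : Matrix n n ℝ} (hA : A.IsHermitian) (v : n → ℝ) (k : ℕ) :
    v ⬝ᵥ (A ^ k).mulVec v = ∑ i, ((star hA.eigenvectorUnitary : Matrix n n ℝ).mulVec v i) ^ 2 *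
      hA.eigenvalues i ^ k := by
  have h : A ^ k = (hA.eigenvectorUnitary : Matrix n n ℝ) *
      Matrix.diagonal (fun i => hA.eigenvalues i ^ k) *
      (star hA.eigenvectorUnitary : Matrix n n ℝ) := by
    conv_lhs => rw [hA.spectral_theorem, ← map_pow, Matrix.diagonal_pow]
    simp only [Unitary.conjStarAlgAut_apply]
    rfl
  rw [h, ← Matrix.mulVec_mulVec, ← Matrix.mulVec_mulVec, Matrix.dotProduct_mulVec,
    ← Matrix.mulVec_transpose, ← Matrix.conjTranspose_eq_transpose_of_trivial,
    ← Matrix.star_eq_conjTranspose]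
  simp only [dotProduct, Matrix.mulVec_diagonal]
  exact Finset.sum_congr rfl fun i _ => by ring

/-- A finite nonnegative weight of total mass one is realised by a probability measure on `ℝ`
that integrates every function to the corresponding weighted sum. -/
theorem exists_isProbabilityMeasure_integral_eq_sum {ι : Type*} [Fintype ι] (w x : ι → ℝ)
    (hw : ∀ i, 0 ≤ w i) (hsum : ∑ i, w i = 1) :
    ∃ μ : Measure ℝ, IsProbabilityMeasure μ ∧
      ∀ f : ℝ → ℝ, Integrable f μ ∧ ∫ t, f t ∂μ = ∑ i, w i * f (x i) := by
  have hint (f : ℝ → ℝ) (i : ι) :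
      Integrable f (ENNReal.ofReal (w i) • Measure.dirac (x i)) :=
    (integrable_dirac (by simp)).smul_measure ENNReal.ofReal_ne_top
  refine ⟨∑ i, ENNReal.ofReal (w i) • Measure.dirac (x i), ⟨?_⟩, fun f => ⟨?_, ?_⟩⟩
  · simp [← ENNReal.ofReal_sum_of_nonneg fun i _ => hw i, hsum]
  · exact integrable_finsetSum_measure.2 fun i _ => hint f i
  · rw [integral_finsetSum_measure fun i _ => hint f i]
    simp [hw]

/-- If a positive definite matrix `M` and a symmetric matrix `H` satisfy `H i = M (i + 1)` on
columns, then some symmetric `A` and vectors `b i = Aⁱ b 0` have Gram matrix `M`. -/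
theorem exists_isHermitian_gram_eq_of_shift {d : ℕ} {M H : Matrix (Fin (d + 1)) (Fin (d + 1)) ℝ}
    (hM : M.PosDef) (hH : H.IsSymm) (hshift : ∀ (i : Fin d) j, H j i.castSucc = M j i.succ) :
    ∃ (A : Matrix (Fin (d + 1)) (Fin (d + 1)) ℝ) (v : Fin (d + 1) → ℝ), A.IsHermitian ∧
      ∀ i j : Fin (d + 1), M i j = v ⬝ᵥ (A ^ ((i : ℕ) + (j : ℕ))).mulVec v := by
  obtain ⟨B, hB, hMB⟩ := hM.exists_isUnit_eq_transpose_mul_self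
  have hBdet : IsUnit B.det := B.isUnit_iff_isUnit_det.1 hB
  have hBTdet : IsUnit B.transpose.det := by rwa [Matrix.det_transpose]
  set A := B⁻¹.transpose * H * B⁻¹ with hA
  have hAsymm : A.transpose = A := by
    simp [hA, Matrix.transpose_mul, hH.eq, Matrix.mul_assoc]
  have hAB : A * B = B⁻¹.transpose * H := by
    rw [hA, Matrix.mul_assoc, Matrix.nonsing_inv_mul _ hBdet, Matrix.mul_one]
  have hBM : B⁻¹.transpose * M = B := by
    rw [hMB, Matrix.transpose_nonsing_inv, ← Matrix.mul_assoc, Matrix.nonsing_inv_mul _ hBTdet,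
      Matrix.one_mul]
  have hstep (i : Fin d) : A.mulVec (B.col i.castSucc) = B.col i.succ := by
    ext k
    change (A * B) k i.castSucc = B k i.succ
    rw [hAB, ← congrFun₂ hBM k i.succ, Matrix.mul_apply, Matrix.mul_apply]
    simp only [hshift]
  have hcol (i : Fin (d + 1)) : B.col i = (A ^ (i : ℕ)).mulVec (B.col 0) := by
    induction i using Fin.induction with
    | zero => simp
    | succ i ih =>
      rw [← hstep, ih, Matrix.mulVec_mulVec, Fin.val_succ, pow_succ', Fin.val_castSucc]
  refine ⟨A, B.col 0, by rwa [Matrix.IsHermitian, Matrix.conjTranspose_eq_transpose_of_trivial],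
    fun i j => ?_⟩
  have hMij : M i j = B.col i ⬝ᵥ B.col j := by rw [hMB]; rfl
  rw [hMij, hcol i, hcol j, Matrix.dotProduct_mulVec _ (A ^ _), ← Matrix.mulVec_transpose,
    Matrix.transpose_pow, hAsymm, Matrix.mulVec_mulVec, ← pow_add, dotProduct_comm,
    add_comm (j : ℕ)]

/-- The moment matrix of a measure is positive semidefinite. -/
theorem posSemidef_of_moments {d : ℕ} {μ : Measure ℝ} {M : Matrix (Fin (d + 1)) (Fin (d + 1)) ℝ}
    (hint : ∀ i j : Fin (d + 1), Integrable (fun x : ℝ => x ^ ((i : ℕ) + (j : ℕ))) μ)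
    (hM : ∀ i j, M i j = ∫ x : ℝ, x ^ ((i : ℕ) + (j : ℕ)) ∂μ) : M.PosSemidef := by
  refine Matrix.PosSemidef.of_dotProduct_mulVec_nonneg ?_ fun v => ?_
  · ext i j
    simp [hM, add_comm]
  · have hterm (i j : Fin (d + 1)) :
        Integrable (fun x : ℝ => v i * v j * x ^ ((i : ℕ) + (j : ℕ))) μ :=
      (hint i j).const_mul _
    have h : star v ⬝ᵥ M.mulVec v = ∫ x : ℝ, (∑ i, v i * x ^ (i : ℕ)) ^ 2 ∂μ := by
      calc star v ⬝ᵥ M.mulVec v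
          = ∑ i, ∑ j, ∫ x : ℝ, v i * v j * x ^ ((i : ℕ) + (j : ℕ)) ∂μ := by
            simp only [dotProduct, Matrix.mulVec, Finset.mul_sum, integral_const_mul, hM,
              Pi.star_apply, star_trivial]
            exact Finset.sum_congr rfl fun i _ => Finset.sum_congr rfl fun j _ => by ring
        _ = ∫ x : ℝ, ∑ i, ∑ j, v i * v j * x ^ ((i : ℕ) + (j : ℕ)) ∂μ := by
            rw [integral_finsetSum _ fun i _ => integrable_finsetSum _ fun j _ => hterm i j]
            exact Finset.sum_congr rfl fun i _ =>
              (integral_finsetSum _ fun j _ => hterm i j).symm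
        _ = ∫ x : ℝ, (∑ i, v i * x ^ (i : ℕ)) ^ 2 ∂μ := by
            congr 1 with x
            rw [sq, Finset.sum_mul_sum]
            exact Finset.sum_congr rfl fun i _ => Finset.sum_congr rfl fun j _ => by ring
    rw [h]
    exact integral_nonneg fun x => sq_nonneg _

/-- **The truncated Hamburger moment problem** (univariate case): a sequence
`(y₀,…,y_{2d})` with `y₀ = 1` that admits a representing probability measure has a
positive semidefinite Hankel moment matrix; conversely, positive definiteness of the
Hankel moment matrix implies the existence of a representing probability measure. -/
theorem univariate_truncated_moment_problem
    (d : ℕ) (y : Fin (2 * d + 1) → ℝ) (hy0 : y ⟨0, by omega⟩ = 1) :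
    ((∃ μ : Measure ℝ, IsProbabilityMeasure μ ∧
        ∀ i : Fin (2 * d + 1), Integrable (fun x : ℝ => x ^ (i : ℕ)) μ ∧
          y i = ∫ x : ℝ, x ^ (i : ℕ) ∂μ) →
      (Matrix.of fun i j : Fin (d + 1) => y ⟨(i : ℕ) + (j : ℕ), by omega⟩).PosSemidef) ∧
    ((Matrix.of fun i j : Fin (d + 1) => y ⟨(i : ℕ) + (j : ℕ), by omega⟩).PosDef →
      ∃ μ : Measure ℝ, IsProbabilityMeasure μ ∧
        ∀ i : Fin (2 * d + 1), Integrable (fun x : ℝ => x ^ (i : ℕ)) μ ∧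
          y i = ∫ x : ℝ, x ^ (i : ℕ) ∂μ) := by
  constructor
  · rintro ⟨μ, -, hμ⟩
    exact posSemidef_of_moments (fun i j => (hμ ⟨(i : ℕ) + (j : ℕ), by omega⟩).1)
      fun i j => (hμ ⟨(i : ℕ) + (j : ℕ), by omega⟩).2
  · intro hM
    let H : Matrix (Fin (d + 1)) (Fin (d + 1)) ℝ := Matrix.of fun i j =>
      if h : (i : ℕ) + (j : ℕ) + 1 < 2 * d + 1 then y ⟨(i : ℕ) + (j : ℕ) + 1, h⟩ else 0
    have hH : H.IsSymm := by
      ext i j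
      simp only [H, Matrix.transpose_apply, Matrix.of_apply, add_comm (j : ℕ)]
    obtain ⟨A, v, hA, hgram⟩ := exists_isHermitian_gram_eq_of_shift hM hH fun i j => by
      have h : (j : ℕ) + (i : ℕ) + 1 < 2 * d + 1 := by omega
      exact dif_pos h
    have hy (k : Fin (2 * d + 1)) : y k = v ⬝ᵥ (A ^ (k : ℕ)).mulVec v := by
      have hk : min (k : ℕ) d + ((k : ℕ) - min (k : ℕ) d) = k := by omega
      have := hgram ⟨min (k : ℕ) d, by omega⟩ ⟨(k : ℕ) - min (k : ℕ) d, by omega⟩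
      simpa only [Matrix.of_apply, hk, Fin.eta] using this
    simp only [hA.dotProduct_pow_mulVec] at hy
    obtain ⟨μ, hμ, hint⟩ := exists_isProbabilityMeasure_integral_eq_sum
      (fun i => ((star hA.eigenvectorUnitary : Matrix _ _ ℝ).mulVec v i) ^ 2) hA.eigenvalues
      (fun i => sq_nonneg _) (by simpa only [hy0, pow_zero, mul_one] using (hy ⟨0, by omega⟩).symm)
    exact ⟨μ, hμ, fun k => ⟨(hint _).1, by rw [(hint _).2, hy k]⟩⟩
end

section
/- Let B = ∏_{i=1}^n [a_i, b_i] ⊂ ℝⁿ be a compact full-dimensional box (a_i < b_i for all i), let ρ ∈ {−1,0,1}ⁿ, and let f : ℝⁿ → ℝ be continuously differentiable with monotonicity profile ρ over B, i.e., ρ_j · ∂f/∂x_j (x) ≥ 0 for all x ∈ B and all j with ρ_j ≠ 0. Then for every ε > 0 there exists a polynomial p in n variables such that max_{x∈B} |f(x) − p(x)| < ε and p has the same monotonicity profile ρ over B, i.e., ρ_j · ∂p/∂x_j (x) ≥ 0 for all x ∈ B and all j with ρ_j ≠ 0. -/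
open MvPolynomial

open scoped unitInterval in
/-- Tensor-product Bernstein weights sum to one. -/
theorem sum_prod_bernstein {ι : Type*} [Fintype ι] [DecidableEq ι] (N : ℕ) (t : ι → I) :
    ∑ k : ι → Fin (N + 1), ∏ i, bernstein N (k i) (t i) = 1 := by
  have h := Finset.prod_univ_sum (fun _ : ι => (Finset.univ : Finset (Fin (N + 1))))
    (fun i m => bernstein N m (t i))
  rw [Fintype.piFinset_univ] at h
  rw [← h]
  simp

open scoped unitInterval in
/-- The variance of one coordinate under the tensor-product Bernstein weights. -/
theorem sum_sq_mul_prod_bernstein {ι : Type*} [Fintype ι] [DecidableEq ι] {N : ℕ} (hN : N ≠ 0)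
    (t : ι → I) (i : ι) :
    ∑ k : ι → Fin (N + 1), ((t i : ℝ) - bernstein.z (k i)) ^ 2 * ∏ l, bernstein N (k l) (t l)
      = (t i : ℝ) * (1 - t i) / N := by
  have h := Finset.prod_univ_sum (fun _ : ι => (Finset.univ : Finset (Fin (N + 1))))
    (fun l m => (if l = i then ((t i : ℝ) - bernstein.z m) ^ 2 else 1) * bernstein N m (t l))
  rw [Fintype.piFinset_univ] at h
  have h₁ : ∀ k : ι → Fin (N + 1),
      ((t i : ℝ) - bernstein.z (k i)) ^ 2 * ∏ l, bernstein N (k l) (t l) =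
      ∏ l, (if l = i then ((t i : ℝ) - bernstein.z (k l)) ^ 2 else 1) *
        bernstein N (k l) (t l) := by
    intro k
    rw [Finset.prod_mul_distrib]
    simp
  simp only [h₁]
  rw [← h, ← bernstein.variance hN (t i), Finset.prod_eq_single i]
  · simp
  · intro l _ hl
    simp [hl]
  · simp

open scoped unitInterval in
/-- Tensor-product Bernstein operators approximate continuous functions on the cube uniformly. -/
theorem exists_bernstein_approx {ι : Type*} [Fintype ι] [DecidableEq ι] {F : (ι → I) → ℝ}
    (hF : Continuous F) {ε : ℝ} (hε : 0 < ε) :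
    ∃ N : ℕ, ∀ t : ι → I,
      |F t - ∑ k : ι → Fin (N + 1 + 1), F (fun i => bernstein.z (k i)) *
        ∏ i, bernstein (N + 1) (k i) (t i)| < ε := by
  obtain ⟨M, hM⟩ : ∃ M, ∀ x, |F x| ≤ M := by
    obtain ⟨M, hM⟩ := (isCompact_range hF).isBounded.exists_norm_le
    exact ⟨M, fun x => hM _ ⟨x, rfl⟩⟩
  have hM₀ : 0 ≤ M := (abs_nonneg _).trans (hM 0)
  obtain ⟨δ, hδ₀, hδ⟩ := Metric.uniformContinuous_iff.1
    (CompactSpace.uniformContinuous_of_continuous hF) (ε / 2) (half_pos hε)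
  set K : ℝ := 2 * M / δ ^ 2 with hK
  have hK₀ : 0 ≤ K := by positivity
  have key : ∀ x y : ι → I, |F x - F y| ≤ ε / 2 + K * ∑ i, ((x i : ℝ) - y i) ^ 2 := by
    intro x y
    have hs : 0 ≤ ∑ i, ((x i : ℝ) - y i) ^ 2 := Finset.sum_nonneg fun i _ => sq_nonneg _
    by_cases hxy : dist x y < δ
    · have := hδ hxy
      rw [Real.dist_eq] at this
      nlinarith [mul_nonneg hK₀ hs]
    · obtain ⟨i, hi⟩ : ∃ i, δ ≤ dist (x i) (y i) := by
        by_contra! h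
        exact hxy ((dist_pi_lt_iff hδ₀).2 h)
      have h₁ : δ ^ 2 ≤ ((x i : ℝ) - y i) ^ 2 := by
        rw [Subtype.dist_eq, Real.dist_eq] at hi
        rw [← sq_abs ((x i : ℝ) - y i)]
        gcongr
      have h₂ : δ ^ 2 ≤ ∑ i, ((x i : ℝ) - y i) ^ 2 :=
        h₁.trans (Finset.single_le_sum (f := fun i => ((x i : ℝ) - y i) ^ 2)
          (fun i _ => sq_nonneg _) (Finset.mem_univ i))
      have h₃ : 2 * M ≤ K * ∑ i, ((x i : ℝ) - y i) ^ 2 := by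
        calc 2 * M = K * δ ^ 2 := by rw [hK]; field_simp
          _ ≤ _ := by gcongr
      have h₄ : |F x - F y| ≤ |F x| + |F y| := abs_sub _ _
      linarith [hM x, hM y]
  obtain ⟨N, hN⟩ : ∃ N : ℕ, K * Fintype.card ι / ((N + 1 : ℕ) : ℝ) < ε / 2 := by
    have h := (tendsto_const_div_atTop_nhds_zero_nat (K * Fintype.card ι)).comp
      (Filter.tendsto_add_atTop_nat 1)
    exact (h.eventually_lt_const (half_pos hε)).exists
  refine ⟨N, fun t => ?_⟩
  have hw : ∀ k : ι → Fin (N + 1 + 1), 0 ≤ ∏ i, bernstein (N + 1) (k i) (t i) :=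
    fun k => Finset.prod_nonneg fun i _ => bernstein_nonneg
  calc |F t - ∑ k : ι → Fin (N + 1 + 1), F (fun i => bernstein.z (k i)) *
        ∏ i, bernstein (N + 1) (k i) (t i)|
      = |∑ k : ι → Fin (N + 1 + 1), (F t - F (fun i => bernstein.z (k i))) *
        ∏ i, bernstein (N + 1) (k i) (t i)| := by
        simp only [sub_mul, Finset.sum_sub_distrib]
        rw [← Finset.mul_sum, sum_prod_bernstein, mul_one]
    _ ≤ ∑ k : ι → Fin (N + 1 + 1), (ε / 2 + K * ∑ i, ((t i : ℝ) - bernstein.z (k i)) ^ 2) *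
        ∏ i, bernstein (N + 1) (k i) (t i) := by
        refine (Finset.abs_sum_le_sum_abs _ _).trans (Finset.sum_le_sum fun k _ => ?_)
        rw [abs_mul, abs_of_nonneg (hw k)]
        exact mul_le_mul_of_nonneg_right (key _ _) (hw k)
    _ = ε / 2 + K * ∑ i, (t i : ℝ) * (1 - t i) / ((N + 1 : ℕ) : ℝ) := by
        simp only [add_mul, Finset.sum_add_distrib, mul_assoc, Finset.sum_mul]
        rw [← Finset.mul_sum, sum_prod_bernstein, mul_one, ← Finset.mul_sum, Finset.sum_comm]
        simp only [sum_sq_mul_prod_bernstein (Nat.succ_ne_zero N)]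
    _ ≤ ε / 2 + K * ∑ _i : ι, 1 / ((N + 1 : ℕ) : ℝ) := by
        gcongr with i
        nlinarith [(t i).2.1, (t i).2.2, sq_nonneg (t i : ℝ)]
    _ = ε / 2 + K * Fintype.card ι / ((N + 1 : ℕ) : ℝ) := by
        simp
        ring
    _ < ε := by linarith

/-- A Bernstein combination with monotone coefficients has nonnegative derivative on `[0, 1]`. -/
theorem sum_mul_eval_derivative_bernsteinPolynomial_nonneg {N : ℕ} {c : Fin (N + 1 + 1) → ℝ}
    (hc : ∀ k : Fin (N + 1), c k.castSucc ≤ c k.succ) {t : ℝ} (ht₀ : 0 ≤ t) (ht₁ : t ≤ 1) :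
    0 ≤ ∑ k, c k * (Polynomial.derivative (bernsteinPolynomial ℝ (N + 1) k)).eval t := by
  have hB : ∀ k, 0 ≤ (bernsteinPolynomial ℝ N k).eval t := fun k => by
    have : 0 ≤ 1 - t := by linarith
    simp only [bernsteinPolynomial, Polynomial.eval_mul, Polynomial.eval_pow,
      Polynomial.eval_natCast, Polynomial.eval_X, Polynomial.eval_sub, Polynomial.eval_one]
    positivity
  have hshift : c 0 * (bernsteinPolynomial ℝ N 0).eval t +
      ∑ k : Fin (N + 1), c k.succ * (bernsteinPolynomial ℝ N (k + 1)).eval t =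
      ∑ k : Fin (N + 1), c k.castSucc * (bernsteinPolynomial ℝ N k).eval t := by
    have h₁ := Fin.sum_univ_succ fun k : Fin (N + 1 + 1) =>
      c k * (bernsteinPolynomial ℝ N k).eval t
    have h₂ := Fin.sum_univ_castSucc fun k : Fin (N + 1 + 1) =>
      c k * (bernsteinPolynomial ℝ N k).eval t
    rw [h₁] at h₂
    simpa [bernsteinPolynomial.eq_zero_of_lt ℝ (Nat.lt_succ_self N)] using h₂
  have : ∑ k, c k * (Polynomial.derivative (bernsteinPolynomial ℝ (N + 1) k)).eval t =
      (N + 1) * ∑ k : Fin (N + 1), (c k.succ - c k.castSucc) *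
        (bernsteinPolynomial ℝ N k).eval t := by
    rw [Fin.sum_univ_succ]
    simp only [Fin.val_zero, Fin.val_succ, bernsteinPolynomial.derivative_zero,
      bernsteinPolynomial.derivative_succ, Nat.add_sub_cancel, Polynomial.eval_mul,
      Polynomial.eval_neg, Polynomial.eval_natCast, Polynomial.eval_sub]
    simp only [sub_mul, Finset.sum_sub_distrib, ← hshift]
    have h : ∀ k : Fin (N + 1), c k.succ * (((N + 1 : ℕ) : ℝ) *
        ((bernsteinPolynomial ℝ N k).eval t - (bernsteinPolynomial ℝ N (k + 1)).eval t)) =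
        (N + 1) * (c k.succ * (bernsteinPolynomial ℝ N k).eval t) -
        (N + 1) * (c k.succ * (bernsteinPolynomial ℝ N (k + 1)).eval t) := by
      intro k
      push_cast
      ring
    simp only [h, Finset.sum_sub_distrib, ← Finset.mul_sum]
    push_cast
    ring
  rw [this]
  exact mul_nonneg (by positivity)
    (Finset.sum_nonneg fun k _ => mul_nonneg (sub_nonneg.2 (hc k)) (hB k))

/-- A product of polynomials not involving `X j` is killed by `pderiv j`. -/
theorem MvPolynomial.pderiv_prod_eq_zero {σ ι R : Type*} [CommSemiring R] (j : σ) (s : Finset ι)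
    (q : ι → MvPolynomial σ R) (hq : ∀ i ∈ s, pderiv j (q i) = 0) :
    pderiv j (∏ i ∈ s, q i) = 0 := by
  refine Finset.prod_induction q (fun p => pderiv j p = 0) (fun p r hp hr => ?_) ?_ hq
  · simp [Derivation.leibniz, hp, hr]
  · simp

/-- The affine coordinate on `[α, β]`, normalised to `[0, 1]`, in the variable `X i`. -/
noncomputable def boxCoord {n : ℕ} (a b : Fin n → ℝ) (i : Fin n) : MvPolynomial (Fin n) ℝ :=
  C (b i - a i)⁻¹ * (X i - C (a i))

/-- The tensor-product Bernstein basis polynomial of degree `N` and index `k` on the box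
`[a, b]`. -/
noncomputable def boxBernstein {n : ℕ} (a b : Fin n → ℝ) (N : ℕ) (k : Fin n → Fin (N + 1)) :
    MvPolynomial (Fin n) ℝ :=
  ∏ i, Polynomial.aeval (boxCoord a b i) (bernsteinPolynomial ℝ N (k i))

theorem eval_boxCoord {n : ℕ} (a b x : Fin n → ℝ) (i : Fin n) :
    eval x (boxCoord a b i) = (b i - a i)⁻¹ * (x i - a i) := by
  simp [boxCoord]

theorem eval_aeval_boxCoord {n : ℕ} (a b x : Fin n → ℝ) (i : Fin n) (q : Polynomial ℝ) :
    eval x (Polynomial.aeval (boxCoord a b i) q) = q.eval ((b i - a i)⁻¹ * (x i - a i)) := by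
  rw [← eval_boxCoord, ← MvPolynomial.coe_aeval_eq_eval]
  exact (Polynomial.aeval_algHom_apply (MvPolynomial.aeval x) _ _).symm.trans (by simp)

theorem eval_pderiv_boxBernstein {n : ℕ} (a b x : Fin n → ℝ) (N : ℕ) (k : Fin n → Fin (N + 1))
    (j : Fin n) :
    eval x (pderiv j (boxBernstein a b N k)) =
      (Polynomial.derivative (bernsteinPolynomial ℝ N (k j))).eval
        ((b j - a j)⁻¹ * (x j - a j)) * ((b j - a j)⁻¹ *
      ∏ i : {i // i ≠ j},
        (bernsteinPolynomial ℝ N (k i)).eval ((b i - a i)⁻¹ * (x i - a i))) := by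
  have h₀ : pderiv j (∏ i : {i // i ≠ j},
      Polynomial.aeval (boxCoord a b i) (bernsteinPolynomial ℝ N (k i))) = 0 := by
    refine pderiv_prod_eq_zero _ _ _ fun i _ => ?_
    rw [Derivation.map_aeval]
    simp [boxCoord, Derivation.leibniz, pderiv_X_of_ne i.2]
  have h₁ : pderiv j (boxCoord a b j) = C (b j - a j)⁻¹ := by
    simp [boxCoord, Derivation.leibniz]
  rw [boxBernstein, Fintype.prod_eq_mul_prod_subtype_ne _ j, Derivation.leibniz, h₀,
    Derivation.map_aeval, h₁]
  simp only [smul_eq_mul, mul_zero, zero_add, map_mul, map_prod, eval_aeval_boxCoord, eval_C]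
  ring

/-- Along one coordinate, a function with signed partial derivative is monotone up to the sign. -/
theorem mul_le_mul_update_of_fderiv_nonneg {n : ℕ} {a b : Fin n → ℝ} {f : (Fin n → ℝ) → ℝ}
    (hf : ContDiff ℝ 1 f) (r : ℝ) (j : Fin n)
    (h : ∀ x ∈ Set.Icc a b, 0 ≤ r * fderiv ℝ f x (Pi.single j 1))
    {x y : Fin n → ℝ} (hx : x ∈ Set.Icc a b) (hy : y ∈ Set.Icc a b)
    (hxy : ∀ i ≠ j, x i = y i) (hj : x j ≤ y j) : r * f x ≤ r * f y := by
  have hd : ∀ s, HasDerivAt (fun s => r * f (Function.update x j s))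
      (r * fderiv ℝ f (Function.update x j s) (Pi.single j 1)) s := fun s =>
    (((hf.differentiable one_ne_zero _).hasFDerivAt.comp_hasDerivAt s
      (hasDerivAt_update x j s))).const_mul r
  have hmono : MonotoneOn (fun s => r * f (Function.update x j s)) (Set.Icc (a j) (b j)) := by
    refine monotoneOn_of_deriv_nonneg (convex_Icc _ _)
      (fun s _ => (hd s).continuousAt.continuousWithinAt)
      (fun s _ => (hd s).differentiableAt.differentiableWithinAt) fun s hs => ?_
    rw [(hd s).deriv]
    refine h _ ?_
    have hs' := interior_subset hs
    exact ⟨le_update_iff.2 ⟨hs'.1, fun i _ => hx.1 i⟩, update_le_iff.2 ⟨hs'.2, fun i _ => hx.2 i⟩⟩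
  have := hmono ⟨hx.1 j, hx.2 j⟩ ⟨hy.1 j, hy.2 j⟩ hj
  have hy' : Function.update x j (y j) = y := by
    ext i
    by_cases hi : i = j
    · subst hi; simp
    · simp [hi, hxy i hi]
  simpa [hy'] using this

/-- **Monotone polynomial approximation** : a continuously differentiable function with
monotonicity profile `ρ` over a compact box `B` can be uniformly approximated on `B`,
to any accuracy, by a polynomial with the same monotonicity profile over `B`. -/
theorem monotone_polynomial_approximation
    (n : ℕ) (a b : Fin n → ℝ) (hab : ∀ i, a i < b i)
    (ρ : Fin n → ℝ) (hρ : ∀ j, ρ j = -1 ∨ ρ j = 0 ∨ ρ j = 1)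
    (f : (Fin n → ℝ) → ℝ) (hf : ContDiff ℝ 1 f)
    (hmono : ∀ x ∈ Set.Icc a b, ∀ j, ρ j ≠ 0 →
      0 ≤ ρ j * fderiv ℝ f x (Pi.single j 1)) :
    ∀ ε > (0:ℝ), ∃ p : MvPolynomial (Fin n) ℝ,
      (∀ x ∈ Set.Icc a b, |f x - eval x p| < ε) ∧
      (∀ x ∈ Set.Icc a b, ∀ j, ρ j ≠ 0 →
        0 ≤ ρ j * eval x (pderiv j p)) := by
  intro ε hε
  set φ : (Fin n → unitInterval) → Fin n → ℝ := fun t i => a i + (b i - a i) * t i with hφ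
  have hφc : Continuous φ := by fun_prop
  have hφm : ∀ t, φ t ∈ Set.Icc a b := fun t =>
    ⟨fun i => by nlinarith [hab i, (t i).2.1], fun i => by nlinarith [hab i, (t i).2.2]⟩
  have hcoord : ∀ x ∈ Set.Icc a b, ∀ i, (b i - a i)⁻¹ * (x i - a i) ∈ unitInterval := by
    intro x hx i
    have h₀ : 0 < b i - a i := sub_pos.2 (hab i)
    refine ⟨mul_nonneg (inv_nonneg.2 h₀.le) (sub_nonneg.2 (hx.1 i)), ?_⟩
    rw [inv_mul_le_one₀ h₀]
    linarith [hx.2 i]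
  obtain ⟨N, hN⟩ := exists_bernstein_approx (hf.continuous.comp hφc) hε
  refine ⟨∑ k : Fin n → Fin (N + 1 + 1), C (f (φ fun i => bernstein.z (k i))) *
    boxBernstein a b (N + 1) k, fun x hx => ?_, fun x hx j hj => ?_⟩
  · have h := hN fun i => ⟨_, hcoord x hx i⟩
    have hx' : φ (fun i => ⟨_, hcoord x hx i⟩) = x := by
      ext i
      have h₀ : b i - a i ≠ 0 := (sub_pos.2 (hab i)).ne'
      simp only [hφ]
      field_simp
      ring
    simp only [Function.comp_apply, hx'] at h
    simp only [map_sum, map_mul, eval_C, boxBernstein, map_prod, eval_aeval_boxCoord]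
    exact h
  · have hp : ρ j * eval x (pderiv j (∑ k : Fin n → Fin (N + 1 + 1),
        C (f (φ fun i => bernstein.z (k i))) * boxBernstein a b (N + 1) k)) =
        ∑ k : Fin n → Fin (N + 1 + 1), ρ j * f (φ fun i => bernstein.z (k i)) *
          eval x (pderiv j (boxBernstein a b (N + 1) k)) := by
      simp [Finset.mul_sum, mul_assoc]
    rw [hp, ← (Equiv.piSplitAt j fun _ => Fin (N + 1 + 1)).symm.sum_comp, Fintype.sum_prod_type,
      Finset.sum_comm]
    refine Finset.sum_nonneg fun r _ => ?_
    set κ : Fin (N + 1 + 1) → Fin n → Fin (N + 1 + 1) := fun m =>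
      (Equiv.piSplitAt j fun _ => Fin (N + 1 + 1)).symm (m, r) with hκ
    have hκj : ∀ m, κ m j = m := fun m => by simp [hκ, Equiv.piSplitAt]
    have hκi : ∀ m, ∀ i : {i // i ≠ j}, κ m i = r i := fun m i => by
      simp [hκ, Equiv.piSplitAt, i.2]
    have hterm : ∀ m, ρ j * f (φ fun i => bernstein.z (κ m i)) *
        eval x (pderiv j (boxBernstein a b (N + 1) (κ m))) =
        (ρ j * f (φ fun i => bernstein.z (κ m i))) *
        (Polynomial.derivative (bernsteinPolynomial ℝ (N + 1) m)).eval
          ((b j - a j)⁻¹ * (x j - a j)) * ((b j - a j)⁻¹ *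
        ∏ i : {i // i ≠ j},
          (bernsteinPolynomial ℝ (N + 1) (r i)).eval ((b i - a i)⁻¹ * (x i - a i))) := by
      intro m
      simp only [eval_pderiv_boxBernstein, hκj, hκi, mul_assoc]
    rw [Finset.sum_congr rfl fun m _ => hterm m, ← Finset.sum_mul]
    refine mul_nonneg (sum_mul_eval_derivative_bernsteinPolynomial_nonneg (fun m => ?_)
      (hcoord x hx j).1 (hcoord x hx j).2) (mul_nonneg (inv_nonneg.2 (sub_pos.2 (hab j)).le)
      (Finset.prod_nonneg fun i _ => ?_))
    · refine mul_le_mul_update_of_fderiv_nonneg hf (ρ j) j (fun y hy => hmono y hy j hj)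
        (hφm _) (hφm _) (fun i hi => ?_) ?_
      · simp only [hφ, hκi _ ⟨i, hi⟩]
      · have h₀ : 0 ≤ b j - a j := (sub_pos.2 (hab j)).le
        simp only [hφ, hκj, bernstein.z, Fin.val_castSucc, Fin.val_succ]
        gcongr
        simp
    · exact bernstein_nonneg (n := N + 1) (ν := r i) (x := ⟨_, hcoord x hx i⟩)
end

section
/- Let M be a real symmetric n×n matrix and define the associated quartic form m(x) = ∑_{i=1}^n ∑_{j=1}^n M_{ij} x_i² x_j². Then M can be written as M = P + N, where P is a positive semidefinite symmetric matrix and N is a symmetric matrix with all entries nonnegative, if and only if m(x) is a sum of squares of polynomials. -/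
open MvPolynomial

/-- A real polynomial bounded by a multiple of `1 + t ^ 2` is quadratic. -/
lemma Polynomial.exists_eval_eq_quadratic {p : Polynomial ℝ} {K : ℝ}
    (h : ∀ t, |p.eval t| ≤ K * (1 + t ^ 2)) :
    ∃ a b c : ℝ, ∀ t, p.eval t = a * t ^ 2 + b * t + c := by
  let Q : Polynomial ℝ := Polynomial.X ^ 2 + Polynomial.C 1
  have hQdeg : Q.degree = 2 := Polynomial.degree_X_pow_add_C two_pos 1
  have hQ : Q ≠ 0 := fun h0 => by simp [h0] at hQdeg
  have hdeg : p.degree ≤ 2 := by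
    by_contra! hlt
    obtain ⟨t, ht⟩ := ((p.abs_div_tendsto_atTop_atTop_of_degree_gt Q (hQdeg ▸ hlt)
      hQ).eventually_gt_atTop K).exists
    have hpos : 0 < 1 + t ^ 2 := by positivity
    have hQt : Q.eval t = 1 + t ^ 2 := by simp [Q, add_comm]
    rw [hQt, abs_div, abs_of_pos hpos, lt_div_iff₀ hpos] at ht
    exact (h t).not_gt ht
  refine ⟨p.coeff 2, p.coeff 1, p.coeff 0, fun t => ?_⟩
  conv_lhs => rw [Polynomial.eq_quadratic_of_degree_le_two hdeg]
  simp

lemma sum_sq_add_smul_le {ι : Type*} [Fintype ι] (x y : ι → ℝ) (t : ℝ) :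
    ∑ i, (x + t • y) i ^ 2 ≤ 2 * (∑ i, x i ^ 2 + ∑ i, y i ^ 2) * (1 + t ^ 2) := by
  rw [← Finset.sum_add_distrib, Finset.mul_sum, Finset.sum_mul]
  refine Finset.sum_le_sum fun i _ => ?_
  simp only [Pi.add_apply, Pi.smul_apply, smul_eq_mul]
  nlinarith [sq_nonneg (x i - t * y i), sq_nonneg (t * x i), sq_nonneg (y i)]

namespace MvPolynomial

variable {ι : Type*} [Fintype ι] {q : MvPolynomial ι ℝ} {K : ℝ}

lemma exists_eval_add_smul_eq_quadratic (hK : 0 ≤ K)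
    (h : ∀ x, |eval x q| ≤ K * ∑ i, x i ^ 2) (x y : ι → ℝ) :
    ∃ a b c : ℝ, ∀ t : ℝ, eval (x + t • y) q = a * t ^ 2 + b * t + c := by
  let p : Polynomial ℝ :=
    aeval (fun i => Polynomial.C (x i) + Polynomial.X * Polynomial.C (y i)) q
  have hp (t : ℝ) : p.eval t = eval (x + t • y) q := by
    rw [← Polynomial.coe_evalRingHom, map_aeval, eval]
    congr 2
    · ext; simp
    · ext; simp [mul_comm t]
  simp only [← hp]
  refine Polynomial.exists_eval_eq_quadratic
    (K := K * (2 * (∑ i, x i ^ 2 + ∑ i, y i ^ 2))) fun t => ?_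
  rw [hp, mul_assoc]
  exact (h _).trans (mul_le_mul_of_nonneg_left (sum_sq_add_smul_le x y t) hK)

lemma eval_smul_of_abs_eval_le (hK : 0 ≤ K)
    (h : ∀ x, |eval x q| ≤ K * ∑ i, x i ^ 2) (x : ι → ℝ) (t : ℝ) :
    eval (t • x) q = t ^ 2 * eval x q := by
  obtain ⟨a, b, c, habc⟩ := exists_eval_add_smul_eq_quadratic hK h 0 x
  simp only [zero_add] at habc
  set L := K * ∑ i, x i ^ 2 with hL
  have hL0 : 0 ≤ L := by positivity
  have hbound (s : ℝ) : |a * s ^ 2 + b * s + c| ≤ L * s ^ 2 := by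
    rw [← habc]
    refine (h _).trans_eq ?_
    simp only [Pi.smul_apply, smul_eq_mul, mul_pow, ← Finset.mul_sum, hL]
    ring
  have hc : c = 0 := by simpa using hbound 0
  subst hc
  have hb : b = 0 := by
    have hD : 0 < L + |a| + 1 := by positivity
    have hs := hbound (b / (L + |a| + 1))
    have hle := (abs_le.mp hs).2
    have ha : -|a| * (b / (L + |a| + 1)) ^ 2 ≤ a * (b / (L + |a| + 1)) ^ 2 :=
      mul_le_mul_of_nonneg_right (neg_abs_le a) (sq_nonneg _)
    have hb' : b * (b / (L + |a| + 1)) = (L + |a| + 1) * (b / (L + |a| + 1)) ^ 2 := by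
      field_simp
    have hzero : (b / (L + |a| + 1)) ^ 2 ≤ 0 := by linarith
    simpa [hD.ne'] using hzero.antisymm (sq_nonneg _)
  have h1 := habc 1
  rw [one_smul] at h1
  rw [habc, h1, hb]
  ring

/-- A polynomial bounded by a multiple of the squared Euclidean norm satisfies the
parallelogram law. -/
lemma eval_add_add_eval_sub_of_abs_eval_le (hK : 0 ≤ K)
    (h : ∀ x, |eval x q| ≤ K * ∑ i, x i ^ 2) (x y : ι → ℝ) :
    eval (x + y) q + eval (x - y) q = 2 * (eval x q + eval y q) := by
  obtain ⟨a, b, c, hu⟩ := exists_eval_add_smul_eq_quadratic hK h x y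
  obtain ⟨a', b', c', hv⟩ := exists_eval_add_smul_eq_quadratic hK h y x
  have hinv (t : ℝ) (ht : t ≠ 0) :
      a * t ^ 2 + b * t + c = t ^ 2 * (a' * t⁻¹ ^ 2 + b' * t⁻¹ + c') := by
    rw [← hu, ← hv, ← eval_smul_of_abs_eval_le hK h, smul_add, smul_smul, mul_inv_cancel₀ ht,
      one_smul, add_comm]
  have h1 := hinv 1 (by norm_num)
  have h2 := hinv (-1) (by norm_num)
  have h3 := hinv 2 (by norm_num)
  norm_num at h1 h2 h3
  have hx := hu 0
  have hy := hv 0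
  have hadd := hu 1
  have hsub := hu (-1)
  simp only [zero_smul, add_zero, one_smul, neg_smul, ← sub_eq_add_neg] at hx hy hadd hsub
  linarith

lemma _root_.IsSumSq.eval_nonneg {σ : Type*} {s : MvPolynomial σ ℝ} (hs : IsSumSq s) (x : σ → ℝ) :
    0 ≤ eval x s := by
  induction hs with
  | zero => simp
  | sq_add q _ ih => simpa using add_nonneg (mul_self_nonneg _) ih

/-- For a sum of squares of quartic growth there is a positive semidefinite matrix whose diagonal
consists of its values at the basis vectors `e i`, and whose entries at `i`, `j` are bounded by its
values at `e i + e j` and `e i - e j`. -/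
lemma _root_.IsSumSq.exists_posSemidef_le [DecidableEq ι] (hK : 0 ≤ K) {s : MvPolynomial ι ℝ}
    (hs : IsSumSq s) (h : ∀ x, eval x s ≤ (K * ∑ i, x i ^ 2) ^ 2) :
    ∃ P : Matrix ι ι ℝ, P.PosSemidef ∧ (∀ i, P i i = eval (Pi.single i 1) s) ∧
      ∀ i j, 2 * (P i i + P j j + 2 * P i j) ≤
        eval (Pi.single i 1 + Pi.single j 1) s + eval (Pi.single i 1 - Pi.single j 1) s := by
  induction hs with
  | zero => exact ⟨0, .zero, by simp, by simp⟩
  | @sq_add q s hs ih =>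
    have hs0 (x : ι → ℝ) : 0 ≤ eval x s := hs.eval_nonneg x
    simp only [map_add, map_mul] at h ⊢
    obtain ⟨P, hP, hdiag, hoff⟩ := ih fun x => by linarith [h x, mul_self_nonneg (eval x q)]
    have hq (x : ι → ℝ) : |eval x q| ≤ K * ∑ i, x i ^ 2 :=
      abs_le_of_sq_le_sq (by linarith [h x, hs0 x]) (by positivity)
    let v : ι → ℝ := fun i => eval (Pi.single i 1) q
    refine ⟨Matrix.vecMulVec v (star v) + P, (Matrix.posSemidef_vecMulVec_self_star v).add hP,
      fun i => by simp [Matrix.vecMulVec_apply, v, hdiag], fun i j => ?_⟩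
    have hpar := eval_add_add_eval_sub_of_abs_eval_le hK hq (Pi.single i 1) (Pi.single j 1)
    simp only [Matrix.add_apply, Matrix.vecMulVec_apply, star_trivial, v]
    nlinarith [hoff i j, sq_nonneg (eval (Pi.single i 1 + Pi.single j 1) q -
      eval (Pi.single i 1 - Pi.single j 1) q), congrArg (· ^ 2) hpar]

lemma isSumSq_C_of_nonneg {σ : Type*} {a : ℝ} (ha : 0 ≤ a) :
    IsSumSq (C a : MvPolynomial σ ℝ) := by
  rw [← Real.mul_self_sqrt ha, C_mul]
  exact .mul_self _

end MvPolynomial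

namespace Matrix

variable {ι : Type*} [Fintype ι]

/-- The quartic form `∑ i j, M i j * x i ^ 2 * x j ^ 2`. -/
noncomputable def quarticForm (M : Matrix ι ι ℝ) : MvPolynomial ι ℝ :=
  ∑ i, ∑ j, C (M i j) * (X i ^ 2 * X j ^ 2)

lemma quarticForm_add (M N : Matrix ι ι ℝ) :
    (M + N).quarticForm = M.quarticForm + N.quarticForm := by
  simp [quarticForm, add_mul, Finset.sum_add_distrib]

lemma quarticForm_sum {κ : Type*} (s : Finset κ) (M : κ → Matrix ι ι ℝ) :
    (∑ k ∈ s, M k).quarticForm = ∑ k ∈ s, (M k).quarticForm := by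
  simp only [quarticForm, sum_apply, map_sum, Finset.sum_mul]
  rw [Finset.sum_comm (s := s)]
  exact Finset.sum_congr rfl fun i _ => Finset.sum_comm

lemma quarticForm_vecMulVec (v : ι → ℝ) :
    (vecMulVec v v).quarticForm = (∑ i, C (v i) * X i ^ 2) * ∑ i, C (v i) * X i ^ 2 := by
  rw [Finset.sum_mul_sum]
  refine Finset.sum_congr rfl fun i _ => Finset.sum_congr rfl fun j _ => ?_
  rw [vecMulVec_apply, C_mul]
  ring

lemma PosSemidef.isSumSq_quarticForm {P : Matrix ι ι ℝ} (hP : P.PosSemidef) :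
    IsSumSq P.quarticForm := by
  obtain ⟨m, v, rfl⟩ := posSemidef_iff_eq_sum_vecMulVec.mp hP
  rw [quarticForm_sum]
  refine IsSumSq.sum fun k _ => ?_
  rw [star_trivial, quarticForm_vecMulVec]
  exact .mul_self _

lemma isSumSq_quarticForm_of_nonneg {N : Matrix ι ι ℝ} (hN : ∀ i j, 0 ≤ N i j) :
    IsSumSq N.quarticForm := by
  refine IsSumSq.sum fun i _ => IsSumSq.sum fun j _ => ?_
  rw [← mul_pow, sq]
  exact (isSumSq_C_of_nonneg (hN i j)).mul (.mul_self _)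

lemma eval_quarticForm (M : Matrix ι ι ℝ) (x : ι → ℝ) :
    eval x M.quarticForm = ∑ i, ∑ j, M i j * (x i ^ 2 * x j ^ 2) := by
  simp [quarticForm]

lemma eval_quarticForm_le (M : Matrix ι ι ℝ) (x : ι → ℝ) :
    eval x M.quarticForm ≤ ((1 + ∑ i, ∑ j, |M i j|) * ∑ i, x i ^ 2) ^ 2 := by
  have hle (i : ι) : x i ^ 2 ≤ ∑ i, x i ^ 2 :=
    Finset.single_le_sum (f := fun i => x i ^ 2) (fun _ _ => sq_nonneg _) (Finset.mem_univ i)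
  have hS : 0 ≤ ∑ i, ∑ j, |M i j| := by positivity
  calc eval x M.quarticForm = ∑ i, ∑ j, M i j * (x i ^ 2 * x j ^ 2) := eval_quarticForm M x
    _ ≤ ∑ i, ∑ j, |M i j| * ((∑ i, x i ^ 2) * ∑ i, x i ^ 2) := by
        gcongr with i _ j _
        · exact le_abs_self _
        · exact hle i
        · exact hle j
    _ = (∑ i, ∑ j, |M i j|) * (∑ i, x i ^ 2) ^ 2 := by
        simp only [← Finset.sum_mul, sq]
    _ ≤ _ := by
        rw [mul_pow]
        gcongr
        nlinarith

lemma eval_single_quarticForm [DecidableEq ι] (M : Matrix ι ι ℝ) (i : ι) :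
    eval (Pi.single i 1) M.quarticForm = M i i := by
  simp [eval_quarticForm, Pi.single_apply]

lemma eval_single_add_smul_quarticForm [DecidableEq ι] (M : Matrix ι ι ℝ) {i j : ι} (hij : i ≠ j)
    {e : ℝ} (he : e ^ 2 = 1) :
    eval (Pi.single i 1 + e • Pi.single j 1) M.quarticForm = M i i + M i j + M j i + M j j := by
  have hsq (k : ι) : (Pi.single i 1 + e • Pi.single j 1 : ι → ℝ) k ^ 2 =
      (if k = i then 1 else 0) + if k = j then 1 else 0 := by
    by_cases hi : k = i
    · subst hi; simp [hij]
    · by_cases hj : k = j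
      · subst hj; simp [hi, he]
      · simp [hi, hj]
  simp only [eval_quarticForm, hsq]
  simp [mul_add, Finset.sum_add_distrib]
  ring

end Matrix

/-- **Parrilo**: a symmetric matrix `M` decomposes as `M = P + N` with `P` positive
semidefinite and `N` (entrywise) nonnegative if and only if the associated quartic form
`m(x) = ∑_{i,j} M_{ij} x_i² x_j²` is a sum of squares. -/
theorem psd_plus_nonneg_iff_quartic_form_sos
    (n : ℕ) (M : Matrix (Fin n) (Fin n) ℝ) (hM : M.IsSymm) :
    (∃ P N : Matrix (Fin n) (Fin n) ℝ,
        P.PosSemidef ∧ N.IsSymm ∧ (∀ i j, 0 ≤ N i j) ∧ M = P + N) ↔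
      IsSumSq (∑ i : Fin n, ∑ j : Fin n,
        MvPolynomial.C (M i j) * (MvPolynomial.X i ^ 2 * MvPolynomial.X j ^ 2)) := by
  change _ ↔ IsSumSq M.quarticForm
  constructor
  · rintro ⟨P, N, hP, -, hN, rfl⟩
    rw [Matrix.quarticForm_add]
    exact hP.isSumSq_quarticForm.add (Matrix.isSumSq_quarticForm_of_nonneg hN)
  · intro h
    obtain ⟨P, hP, hdiag, hoff⟩ := h.exists_posSemidef_le (by positivity) M.eval_quarticForm_le
    have hPsymm : P.IsSymm := by simpa [Matrix.IsHermitian, Matrix.IsSymm] using hP.isHermitian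
    refine ⟨P, M - P, hP, hM.sub hPsymm, fun i j => ?_, by simp⟩
    simp only [Matrix.eval_single_quarticForm] at hdiag
    rw [Matrix.sub_apply]
    rcases eq_or_ne i j with rfl | hij
    · simp [hdiag]
    · have hadd := M.eval_single_add_smul_quarticForm hij (e := 1) (by norm_num)
      have hsub := M.eval_single_add_smul_quarticForm hij (e := -1) (by norm_num)
      rw [one_smul] at hadd
      rw [neg_one_smul, ← sub_eq_add_neg] at hsub
      linarith [hoff i j, hdiag i, hdiag j, hM.apply i j]
end

section
/- Let M be a real symmetric n×n matrix that is strictly copositive, i.e., xᵀMx > 0 for every nonzero x ∈ ℝⁿ with nonnegative entries. Then there exists a nonnegative integer r such that the polynomial (∑_{i=1}^n x_i²)^r · (∑_{i=1}^n ∑_{j=1}^n M_{ij} x_i² x_j²) is a sum of squares of polynomials. -/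
open MvPolynomial Matrix

/-- A strictly copositive quadratic form dominates a positive multiple of the square of the
coordinate sum on the nonnegative orthant. -/
theorem exists_pos_mul_sum_sq_le_of_strictly_copositive {ι : Type*} [Fintype ι]
    (M : Matrix ι ι ℝ)
    (hcop : ∀ x : ι → ℝ, (∀ i, 0 ≤ x i) → x ≠ 0 → 0 < x ⬝ᵥ M.mulVec x) :
    ∃ δ : ℝ, 0 < δ ∧ ∀ x : ι → ℝ, (∀ i, 0 ≤ x i) → δ * (∑ i, x i) ^ 2 ≤ x ⬝ᵥ M.mulVec x := by
  have hcont : Continuous fun x : ι → ℝ => x ⬝ᵥ M.mulVec x := by fun_prop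
  obtain ⟨δ, hδ, hmin⟩ := (isCompact_stdSimplex ℝ ι).exists_forall_le' hcont.continuousOn
    (a := 0) fun x hx => hcop x hx.1 fun h => by simpa [h] using hx.2
  refine ⟨δ, hδ, fun x hx => ?_⟩
  rcases (Finset.sum_nonneg fun i _ => hx i).eq_or_lt with h0 | hpos
  · have : x = 0 := funext fun i =>
      (Finset.sum_eq_zero_iff_of_nonneg fun i _ => hx i).1 h0.symm i (Finset.mem_univ i)
    simp [this]
  · set s := ∑ i, x i
    have h := hmin (s⁻¹ • x) ⟨fun i => mul_nonneg (inv_nonneg.2 hpos.le) (hx i), by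
      simp [← Finset.mul_sum, s, hpos.ne']⟩
    rw [mulVec_smul, smul_dotProduct, dotProduct_smul, smul_eq_mul, smul_eq_mul, ← mul_assoc] at h
    calc δ * s ^ 2 ≤ s⁻¹ * s⁻¹ * (x ⬝ᵥ M.mulVec x) * s ^ 2 := by gcongr
      _ = x ⬝ᵥ M.mulVec x := by field_simp

/-- Expansion of a power of `∑ yᵢ` times a quadratic form into monomials. -/
theorem sum_X_pow_mul_quadratic_form {R ι : Type*} [CommRing R] [Fintype ι] [DecidableEq ι]
    (M : Matrix ι ι R) (N : ℕ) :
    C (((N + 2) * (N + 1) : R)) * ((∑ i : ι, (X i : MvPolynomial ι R)) ^ N *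
        ∑ i, ∑ j, C (M i j) * (X i * X j)) =
      ∑ a ∈ Finset.piAntidiag Finset.univ (N + 2),
        C ((Nat.multinomial Finset.univ a : R) *
          (∑ i, ∑ j, M i j * (a i * a j) - ∑ i, M i i * a i)) * ∏ i, X i ^ a i := by
  have hexp := Finset.sum_pow_eq_sum_piAntidiag Finset.univ (X : ι → MvPolynomial ι R) (N + 2)
  have hmono (i : ι) (a : ι → ℕ) :
      X i * pderiv i (∏ k, (X k : MvPolynomial ι R) ^ a k) = C (a i : R) * ∏ k, X k ^ a k := by
    have h := X_mul_pderiv_monomial (R := R) (i := i) (m := Finsupp.equivFunOnFinite.symm a)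
      (r := 1)
    rw [monomial_eq] at h
    simpa [Finsupp.prod_fintype, nsmul_eq_mul] using h
  have hS (i : ι) : pderiv i (∑ k, (X k : MvPolynomial ι R)) = 1 := by
    simp [pderiv_X, Pi.single_apply]
  have h1 (i : ι) : X i * pderiv i ((∑ k, (X k : MvPolynomial ι R)) ^ (N + 2)) =
      ∑ a ∈ Finset.piAntidiag Finset.univ (N + 2),
        C ((Nat.multinomial Finset.univ a : R) * a i) * ∏ k, X k ^ a k := by
    rw [hexp, map_sum, Finset.mul_sum]
    refine Finset.sum_congr rfl fun a _ => ?_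
    rw [← map_natCast (C : R →+* MvPolynomial ι R), pderiv_C_mul, mul_left_comm, hmono, C_mul,
      mul_assoc]
  have h2 (i j : ι) :
      X i * pderiv i (X j * pderiv j ((∑ k, (X k : MvPolynomial ι R)) ^ (N + 2))) =
      ∑ a ∈ Finset.piAntidiag Finset.univ (N + 2),
        C ((Nat.multinomial Finset.univ a : R) * (a i * a j)) * ∏ k, X k ^ a k := by
    rw [h1, map_sum, Finset.mul_sum]
    refine Finset.sum_congr rfl fun a _ => ?_
    rw [pderiv_C_mul, mul_left_comm, hmono, ← mul_assoc, ← C_mul]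
    congr 2
    ring
  have h3 (i j : ι) : C (((N + 2) * (N + 1) : R)) * ((∑ k, (X k : MvPolynomial ι R)) ^ N *
      (X i * X j)) =
      X i * pderiv i (X j * pderiv j ((∑ k, (X k : MvPolynomial ι R)) ^ (N + 2))) -
      if i = j then X i * pderiv i ((∑ k, (X k : MvPolynomial ι R)) ^ (N + 2)) else 0 := by
    have htwo : pderiv i (2 : MvPolynomial ι R) = 0 := by
      rw [← map_ofNat (C : R →+* MvPolynomial ι R) 2, pderiv_C]
    have hC : (C 2 : MvPolynomial ι R) = 2 := map_ofNat C 2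
    rcases eq_or_ne i j with rfl | hij
    · simp [hS, htwo, hC]
      ring
    · simp [hS, htwo, hC, hij, pderiv_X_of_ne hij.symm]
      ring
  have h4 : C (((N + 2) * (N + 1) : R)) * ((∑ i : ι, (X i : MvPolynomial ι R)) ^ N *
        ∑ i, ∑ j, C (M i j) * (X i * X j)) =
      ∑ i, ∑ j, C (M i j) * (C (((N + 2) * (N + 1) : R)) *
        ((∑ k, (X k : MvPolynomial ι R)) ^ N * (X i * X j))) := by
    simp only [Finset.mul_sum]
    refine Finset.sum_congr rfl fun i _ => Finset.sum_congr rfl fun j _ => by ring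
  rw [h4]
  simp only [h3, h2, mul_sub, mul_ite, mul_zero, Finset.sum_sub_distrib, Finset.sum_ite_eq,
    Finset.mem_univ, if_true, C_sub, sub_mul]
  simp only [h1, Finset.mul_sum, map_sum, Finset.sum_mul]
  congr 1
  · symm
    rw [Finset.sum_comm]
    refine Finset.sum_congr rfl fun i _ => ?_
    rw [Finset.sum_comm]
    refine Finset.sum_congr rfl fun j _ => Finset.sum_congr rfl fun a _ => ?_
    simp only [C_mul]
    ring
  · symm
    rw [Finset.sum_comm]
    refine Finset.sum_congr rfl fun i _ => Finset.sum_congr rfl fun a _ => ?_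
    simp only [C_mul]
    ring

theorem isSumSq_C_mul_prod_X_sq {ι : Type*} [Fintype ι] {c : ℝ} (hc : 0 ≤ c) (a : ι → ℕ) :
    IsSumSq (C c * ∏ i, ((X i : MvPolynomial ι ℝ) ^ 2) ^ a i) := by
  have : C c * ∏ i, ((X i : MvPolynomial ι ℝ) ^ 2) ^ a i =
      (C (√c) * ∏ i, X i ^ a i) * (C (√c) * ∏ i, X i ^ a i) := by
    rw [mul_mul_mul_comm, ← C_mul, Real.mul_self_sqrt hc, ← Finset.prod_mul_distrib]
    simp only [← pow_two, pow_right_comm _ 2]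
  exact this ▸ IsSumSq.mul_self _

/-- **Pólya-type certificate for strict copositivity**: if `M` is strictly copositive,
then `(∑ xᵢ²)^r · (∑_{i,j} M_{ij} xᵢ² xⱼ²)` is a sum of squares for some `r`. -/
theorem strictly_copositive_polya_sos
    (n : ℕ) (M : Matrix (Fin n) (Fin n) ℝ) (hM : M.IsSymm)
    (hcop : ∀ x : Fin n → ℝ, (∀ i, 0 ≤ x i) → x ≠ 0 → 0 < x ⬝ᵥ M.mulVec x) :
    ∃ r : ℕ, IsSumSq
      ((∑ i : Fin n, (MvPolynomial.X i : MvPolynomial (Fin n) ℝ) ^ 2) ^ r *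
        ∑ i : Fin n, ∑ j : Fin n,
          MvPolynomial.C (M i j) * (MvPolynomial.X i ^ 2 * MvPolynomial.X j ^ 2)) := by
  obtain ⟨δ, hδ, hquad⟩ := exists_pos_mul_sum_sq_le_of_strictly_copositive M hcop
  obtain ⟨N, hN⟩ := exists_nat_ge ((∑ i, |M i i|) / δ)
  rw [div_le_iff₀ hδ] at hN
  have hcoeff (a : Fin n → ℕ) (ha : ∑ i, a i = N + 2) :
      0 ≤ ∑ i, ∑ j, M i j * ((a i : ℝ) * a j) - ∑ i, M i i * a i := by
    have hsum : ∑ i, (a i : ℝ) = N + 2 := by exact_mod_cast ha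
    have hdiag : ∑ i, M i i * a i ≤ (∑ i, |M i i|) * (N + 2) := by
      rw [Finset.sum_mul]
      refine Finset.sum_le_sum fun i _ => mul_le_mul (le_abs_self _) ?_ (by positivity)
        (abs_nonneg _)
      rw [← hsum]
      exact Finset.single_le_sum (f := fun i => (a i : ℝ)) (fun _ _ => by positivity)
        (Finset.mem_univ i)
    have hform : ∑ i, ∑ j, M i j * ((a i : ℝ) * a j) =
        (fun i => (a i : ℝ)) ⬝ᵥ M.mulVec fun i => (a i : ℝ) := by
      simp only [dotProduct, mulVec, Finset.mul_sum]
      exact Finset.sum_congr rfl fun i _ => Finset.sum_congr rfl fun j _ => by ring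
    have h := hquad (fun i => (a i : ℝ)) fun i => by positivity
    rw [hsum, ← hform] at h
    nlinarith [Nat.cast_nonneg (α := ℝ) N]
  refine ⟨N, ?_⟩
  set c : ℝ := (N + 2) * (N + 1) with hc
  have hc0 : 0 < c := by positivity
  have key := congrArg (aeval fun i : Fin n => (X i : MvPolynomial (Fin n) ℝ) ^ 2)
    (sum_X_pow_mul_quadratic_form M N)
  simp only [map_mul (aeval _), map_sum (aeval _), map_pow (aeval _), map_prod (aeval _), aeval_X,
    algHom_C, algebraMap_eq, ← hc] at key
  have hinv (p : MvPolynomial (Fin n) ℝ) : p = C c⁻¹ * (C c * p) := by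
    rw [← mul_assoc, ← C_mul, inv_mul_cancel₀ hc0.ne', C_1, one_mul]
  rw [hinv (_ ^ N * _), key, Finset.mul_sum]
  refine IsSumSq.sum fun a ha => ?_
  rw [← mul_assoc, ← C_mul]
  exact isSumSq_C_mul_prod_X_sq (mul_nonneg (inv_nonneg.2 hc0.le)
    (mul_nonneg (Nat.cast_nonneg _) (hcoeff a (Finset.mem_piAntidiag.1 ha).1))) a
end

section
/- Let G be a simple graph on n vertices with adjacency matrix A, let α(G) denote its stability (independence) number, let I be the n×n identity matrix and e ∈ ℝⁿ the all-ones vector. Then α(G) = min { λ ∈ ℝ : λ(I + A) − eeᵀ is copositive }; that is, the matrix α(G)(I + A) − eeᵀ is copositive, and every λ ∈ ℝ for which λ(I + A) − eeᵀ is copositive satisfies λ ≥ α(G). -/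
open Matrix

namespace SimpleGraph

variable {V : Type*} [Fintype V] [DecidableEq V] (G : SimpleGraph V) [DecidableRel G.Adj]

lemma dotProduct_smul_one_add_adjMatrix_sub_ones_mulVec (c : ℝ) (x : V → ℝ) :
    x ⬝ᵥ ((c • (1 + G.adjMatrix ℝ) - Matrix.of fun _ _ => (1 : ℝ)).mulVec x)
      = c * (x ⬝ᵥ ((1 + G.adjMatrix ℝ) *ᵥ x)) - (∑ i, x i) ^ 2 := by
  have ones : (Matrix.of fun _ _ => (1 : ℝ)) *ᵥ x = fun _ : V => ∑ i, x i := by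
    ext i
    simp [mulVec, dotProduct]
  rw [sub_mulVec, smul_mulVec, dotProduct_sub, dotProduct_smul, smul_eq_mul, ones]
  simp only [dotProduct, ← Finset.sum_mul, sq]

/-- On vectors supported on a stable set, `I + A` acts as the identity quadratic form. -/
lemma dotProduct_one_add_adjMatrix_mulVec_of_stable {s : Finset V}
    (hs : ∀ v ∈ s, ∀ w ∈ s, ¬ G.Adj v w) {x : V → ℝ} (hx : ∀ i ∉ s, x i = 0) :
    x ⬝ᵥ ((1 + G.adjMatrix ℝ) *ᵥ x) = ∑ i ∈ s, x i ^ 2 := by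
  have adj_part : x ⬝ᵥ (G.adjMatrix ℝ *ᵥ x) = 0 := by
    refine Finset.sum_eq_zero fun i _ => ?_
    by_cases hi : i ∈ s
    · rw [adjMatrix_mulVec_apply, Finset.sum_eq_zero, mul_zero]
      intro j hj
      exact hx j fun hjs => hs i hi j hjs ((G.mem_neighborFinset i j).1 hj)
    · rw [hx i hi, zero_mul]
  rw [add_mulVec, one_mulVec, dotProduct_add, adj_part, add_zero, dotProduct]
  simp only [← sq]
  refine (Finset.sum_subset (Finset.subset_univ s) fun i _ hi => ?_).symm
  rw [hx i hi, zero_pow two_ne_zero]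

/-- Along the direction `e_i - e_j` of an edge, the quadratic form of `I + A` is affine. -/
lemma dotProduct_one_add_adjMatrix_mulVec_add_smul {i j : V} (hij : G.Adj i j) (x : V → ℝ)
    (t : ℝ) :
    let d : V → ℝ := Pi.single i 1 - Pi.single j 1
    let B := 1 + G.adjMatrix ℝ
    (x + t • d) ⬝ᵥ (B *ᵥ (x + t • d))
      = x ⬝ᵥ (B *ᵥ x) + 2 * t * ((B *ᵥ x) i - (B *ᵥ x) j) := by
  intro d B
  have symm_B : x ⬝ᵥ (B *ᵥ d) = d ⬝ᵥ (B *ᵥ x) := by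
    have hB : Bᵀ = B := by simp [B]
    rw [dotProduct_mulVec, ← mulVec_transpose, hB, dotProduct_comm]
  have d_dot (y : V → ℝ) : d ⬝ᵥ y = y i - y j := by simp [d, sub_dotProduct]
  have d_B_d : d ⬝ᵥ (B *ᵥ d) = 0 := by
    rw [d_dot]
    simp [d, B, mulVec_sub, hij, hij.symm, hij.ne, hij.ne']
  rw [mulVec_add, mulVec_smul, dotProduct_add, add_dotProduct, add_dotProduct, dotProduct_smul,
    dotProduct_smul, smul_dotProduct, smul_dotProduct, symm_B, d_B_d, d_dot]
  simp only [smul_eq_mul]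
  ring

/-- A form of the Motzkin–Straus inequality, by induction on the size of the support. -/
theorem sq_sum_le_mul_dotProduct_one_add_adjMatrix_mulVec {k : ℕ}
    (hk : ∀ s : Finset V, (∀ v ∈ s, ∀ w ∈ s, ¬ G.Adj v w) → s.card ≤ k)
    (x : V → ℝ) (hx : ∀ i, 0 ≤ x i) :
    (∑ i, x i) ^ 2 ≤ k * (x ⬝ᵥ ((1 + G.adjMatrix ℝ) *ᵥ x)) := by
  induction hm : (Finset.univ.filter fun i => x i ≠ 0).card using Nat.strong_induction_on
    generalizing x with
  | _ m ih =>
  set s := Finset.univ.filter fun i => x i ≠ 0 with s_def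
  have zero_off (i : V) (hi : i ∉ s) : x i = 0 := by simpa [s_def] using hi
  by_cases hs : ∀ v ∈ s, ∀ w ∈ s, ¬ G.Adj v w
  · rw [dotProduct_one_add_adjMatrix_mulVec_of_stable G hs zero_off,
      ← Finset.sum_subset (Finset.subset_univ s) fun i _ hi => zero_off i hi]
    refine sq_sum_le_card_mul_sum_sq.trans ?_
    gcongr
    exact hk s hs
  · obtain ⟨i, hi, j, hj, hij, hle⟩ : ∃ i ∈ s, ∃ j ∈ s, G.Adj i j ∧
        ((1 + G.adjMatrix ℝ) *ᵥ x) i ≤ ((1 + G.adjMatrix ℝ) *ᵥ x) j := by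
      push Not at hs
      obtain ⟨v, hv, w, hw, hvw⟩ := hs
      rcases le_total (((1 + G.adjMatrix ℝ) *ᵥ x) v) (((1 + G.adjMatrix ℝ) *ᵥ x) w) with h | h
      · exact ⟨v, hv, w, hw, hvw, h⟩
      · exact ⟨w, hw, v, hv, hvw.symm, h⟩
    set y : V → ℝ := x + x j • (Pi.single i 1 - Pi.single j 1) with y_def
    have y_i : y i = x i + x j := by simp [y_def, hij.ne]
    have y_j : y j = 0 := by simp [y_def, hij.ne']
    have y_of_ne (l : V) (hli : l ≠ i) (hlj : l ≠ j) : y l = x l := by simp [y_def, hli, hlj]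
    have y_nonneg (l : V) : 0 ≤ y l := by
      by_cases hli : l = i
      · rw [hli, y_i]
        exact add_nonneg (hx i) (hx j)
      by_cases hlj : l = j
      · rw [hlj, y_j]
      · rw [y_of_ne l hli hlj]
        exact hx l
    have card_lt : (Finset.univ.filter fun l => y l ≠ 0).card < m := by
      rw [← hm]
      refine Finset.card_lt_card ((Finset.ssubset_iff_of_subset fun l hl => ?_).2
        ⟨j, hj, by simp [y_j]⟩)
      by_cases hli : l = i
      · exact hli ▸ hi
      by_cases hlj : l = j
      · exact hlj ▸ hj
      · simpa [s_def, y_of_ne l hli hlj] using hl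
    have sum_y : ∑ l, y l = ∑ l, x l := by
      simp [y_def, Finset.sum_add_distrib, ← Finset.mul_sum]
    have form_le : y ⬝ᵥ ((1 + G.adjMatrix ℝ) *ᵥ y) ≤ x ⬝ᵥ ((1 + G.adjMatrix ℝ) *ᵥ x) := by
      rw [y_def, dotProduct_one_add_adjMatrix_mulVec_add_smul G hij]
      linarith [mul_nonneg (hx j) (sub_nonneg.2 hle)]
    rw [← sum_y]
    exact (ih _ card_lt y y_nonneg rfl).trans (by gcongr)

end SimpleGraph

/-- **de Klerk–Pasechnik**: the stability number of a graph is the least `λ` such that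
`λ(I + A) − eeᵀ` is copositive. -/
theorem stability_number_copositive_formulation
    (n : ℕ) (hn : 0 < n) (G : SimpleGraph (Fin n)) [DecidableRel G.Adj]
    (k : ℕ)
    (hk : IsGreatest {m : ℕ | ∃ s : Finset (Fin n),
        (∀ v ∈ s, ∀ w ∈ s, ¬ G.Adj v w) ∧ s.card = m} k) :
    (∀ x : Fin n → ℝ, (∀ i, 0 ≤ x i) →
        0 ≤ x ⬝ᵥ (((k : ℝ) • (1 + G.adjMatrix ℝ)
          - Matrix.of fun _ _ => (1 : ℝ)).mulVec x)) ∧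
    (∀ lam : ℝ,
      (∀ x : Fin n → ℝ, (∀ i, 0 ≤ x i) →
        0 ≤ x ⬝ᵥ ((lam • (1 + G.adjMatrix ℝ)
          - Matrix.of fun _ _ => (1 : ℝ)).mulVec x)) →
      (k : ℝ) ≤ lam) := by
  obtain ⟨⟨s, hs, rfl⟩, hmax⟩ := hk
  refine ⟨fun x hx => ?_, fun lam hlam => ?_⟩
  · rw [G.dotProduct_smul_one_add_adjMatrix_sub_ones_mulVec, sub_nonneg]
    exact G.sq_sum_le_mul_dotProduct_one_add_adjMatrix_mulVec
      (fun t ht => hmax ⟨t, ht, rfl⟩) x hx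
  · have card_pos : 0 < (s.card : ℝ) := by
      have one_le : 1 ≤ s.card := hmax ⟨{⟨0, hn⟩}, by simp, by simp⟩
      exact_mod_cast one_le
    have form_nonneg := hlam (fun i => if i ∈ s then 1 else 0) fun i => by positivity
    rw [G.dotProduct_smul_one_add_adjMatrix_sub_ones_mulVec,
      G.dotProduct_one_add_adjMatrix_mulVec_of_stable hs fun i hi => if_neg hi] at form_nonneg
    simp only [ite_pow, one_pow, zero_pow two_ne_zero, Finset.sum_ite_mem, Finset.univ_inter,
      Finset.inter_self, Finset.sum_const, nsmul_eq_mul, mul_one] at form_nonneg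
    exact le_of_mul_le_mul_right (by linarith) card_pos
end

section
/- Let p, q be positive integers, let A be a real symmetric pq×pq positive semidefinite matrix, viewed as a p×p array of q×q blocks A_{ij}, and let B be a real symmetric q×q positive semidefinite matrix. Then the p×p matrix (A,B)_p whose (i,j) entry is tr(A_{ij} B) is positive semidefinite. -/
open Matrix

/-- Contracting every block of `A` with a vector `v` on both sides is the congruence of `A` by
the block matrix `I ⊗ v`. -/
theorem blockwise_trace_vecMulVec_eq {m n : Type*} [Fintype m] [DecidableEq m] [Fintype n]
    (A : Matrix (m × n) (m × n) ℝ) (v : n → ℝ) :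
    (Matrix.of fun i j : m =>
      Matrix.trace ((Matrix.of fun a b : n => A (i, a) (j, b)) * vecMulVec v (star v))) =
      (Matrix.of fun (x : m × n) (j : m) => if x.1 = j then v x.2 else 0)ᴴ * A *
        Matrix.of fun (x : m × n) (j : m) => if x.1 = j then v x.2 else 0 := by
  ext i j
  simp only [trace, diag_apply, mul_apply, of_apply, vecMulVec_apply, conjTranspose_apply,
    Fintype.sum_prod_type, star_trivial, ite_mul, zero_mul, mul_ite, mul_zero,
    Finset.sum_mul, Finset.sum_ite_irrel, Finset.sum_const_zero, Finset.sum_ite_eq',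
    Finset.mem_univ, if_true]
  rw [Finset.sum_comm]
  exact Finset.sum_congr rfl fun _ _ => Finset.sum_congr rfl fun _ _ => by ring

/-- **Scherer–Hol**: if `A` (a `p×p` array of `q×q` blocks) and `B` are positive
semidefinite, then the `p×p` matrix of block traces `(A,B)_p`, with `(i,j)` entry
`tr(A_{ij} B)`, is positive semidefinite. -/
theorem blockwise_trace_posSemidef
    (p q : ℕ)
    (A : Matrix (Fin p × Fin q) (Fin p × Fin q) ℝ) (hA : A.PosSemidef)
    (B : Matrix (Fin q) (Fin q) ℝ) (hB : B.PosSemidef) :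
    (Matrix.of fun i j : Fin p =>
      Matrix.trace ((Matrix.of fun a b : Fin q => A (i, a) (j, b)) * B)).PosSemidef := by
  obtain ⟨r, v, rfl⟩ := Matrix.posSemidef_iff_eq_sum_vecMulVec.mp hB
  have key : (Matrix.of fun i j : Fin p => Matrix.trace
      ((Matrix.of fun a b : Fin q => A (i, a) (j, b)) * ∑ k, vecMulVec (v k) (star (v k)))) =
      ∑ k, Matrix.of fun i j : Fin p => Matrix.trace
        ((Matrix.of fun a b : Fin q => A (i, a) (j, b)) * vecMulVec (v k) (star (v k))) := by
    ext i j
    simp only [of_apply, Finset.mul_sum, trace_sum, Matrix.sum_apply]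
  rw [key]
  refine posSemidef_sum _ fun k _ => ?_
  rw [blockwise_trace_vecMulVec_eq]
  exact hA.conjTranspose_mul_mul_same _
end

section
/- Let F(x) be a p×p symmetric matrix and G(x) a q×q symmetric matrix whose entries are polynomials in x ∈ ℝᵐ, let ε > 0, and let S(x) be a pq×pq polynomial matrix that is a sum of squares matrix. Suppose the p×p polynomial matrix F(x) + (S(x), G(x))_p − εI_p is also a sum of squares matrix, where (A,B)_p denotes the p×p matrix whose (i,j) entry is tr(A_{ij}B) with A_{ij} the q×q blocks of A. Then for every x₀ ∈ ℝᵐ with G(x₀) negative semidefinite, the matrix F(x₀) is positive definite. -/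
open Matrix MvPolynomial

/-- A polynomial matrix `S(x)` is a sum of squares (sos) matrix if `S(x) = T(x)ᵀ T(x)`
for some polynomial matrix `T(x)`. -/
def IsSosMatrix {m : ℕ} {ι : Type} [Fintype ι]
    (S : Matrix ι ι (MvPolynomial (Fin m) ℝ)) : Prop :=
  ∃ (k : ℕ) (T : Matrix (Fin k) ι (MvPolynomial (Fin m) ℝ)), S = Tᵀ * T

/-- The block trace pairing of a Gram matrix with a positive semidefinite matrix is positive
semidefinite. -/
theorem posSemidef_blockTrace_gram {κ ι α : Type*} [Fintype κ] [Fintype ι] [Fintype α]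
    (T : Matrix κ (ι × α) ℝ) {N : Matrix α α ℝ} (hN : N.PosSemidef) :
    (Matrix.of fun i j : ι =>
      ∑ a : α, ∑ b : α, (Tᵀ * T) (i, a) (j, b) * N b a).PosSemidef := by
  have h : (Matrix.of fun i j : ι => ∑ a : α, ∑ b : α, (Tᵀ * T) (i, a) (j, b) * N b a) =
      ∑ k : κ, (Matrix.of fun i a => T k (i, a)) * Nᵀ * (Matrix.of fun i a => T k (i, a))ᴴ := by
    ext i j
    simp only [Matrix.of_apply, Matrix.sum_apply, Matrix.mul_apply, Matrix.transpose_apply,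
      Matrix.conjTranspose_apply, star_trivial, Finset.sum_mul]
    refine Finset.sum_comm.trans (Eq.trans ?_ Finset.sum_comm)
    refine Finset.sum_congr rfl fun b _ => Eq.trans ?_ Finset.sum_comm
    exact Finset.sum_congr rfl fun a _ => Finset.sum_congr rfl fun k _ => by ring
  rw [h]
  exact Matrix.posSemidef_sum _ fun k _ => hN.transpose.mul_mul_conjTranspose_same _

/-- **Scherer–Hol sos certificate for robust semidefinite programs**: if `S(x)` and
`F(x) + (S(x),G(x))_p − ε I_p` are sos matrices, then `F(x₀) ≻ 0` whenever
`G(x₀) ⪯ 0`. -/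
theorem robust_sdp_sos_certificate
    (m p q : ℕ)
    (F : Matrix (Fin p) (Fin p) (MvPolynomial (Fin m) ℝ)) (hF : F.IsSymm)
    (G : Matrix (Fin q) (Fin q) (MvPolynomial (Fin m) ℝ)) (hG : G.IsSymm)
    (ε : ℝ) (hε : 0 < ε)
    (S : Matrix (Fin p × Fin q) (Fin p × Fin q) (MvPolynomial (Fin m) ℝ))
    (hS : IsSosMatrix S)
    (hFS : IsSosMatrix
      (F + (Matrix.of fun i j : Fin p =>
          ∑ a : Fin q, ∑ b : Fin q, S (i, a) (j, b) * G b a)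
        - (MvPolynomial.C ε : MvPolynomial (Fin m) ℝ) • (1 : Matrix (Fin p) (Fin p) (MvPolynomial (Fin m) ℝ)))) :
    ∀ x₀ : Fin m → ℝ,
      (-(G.map (MvPolynomial.eval x₀))).PosSemidef →
      (F.map (MvPolynomial.eval x₀)).PosDef := by
  intro x₀ hN
  obtain ⟨k, T, rfl⟩ := hS
  obtain ⟨l, R, hR⟩ := hFS
  have hB := posSemidef_blockTrace_gram (T.map (MvPolynomial.eval x₀)) hN
  have hRR := Matrix.posSemidef_conjTranspose_mul_self (R.map (MvPolynomial.eval x₀))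
  have hI : (ε • (1 : Matrix (Fin p) (Fin p) ℝ)).PosDef := Matrix.PosDef.one.smul hε
  convert hI.add_posSemidef (hRR.add hB) using 1
  ext i j
  have h := congrArg (MvPolynomial.eval x₀) (congrFun (congrFun hR i) j)
  simp only [Matrix.add_apply, Matrix.sub_apply, Matrix.smul_apply, Matrix.of_apply,
    Matrix.mul_apply, Matrix.transpose_apply, Matrix.one_apply, smul_eq_mul, map_add, map_sub,
    map_sum, map_mul, MvPolynomial.eval_C, apply_ite (MvPolynomial.eval x₀), map_one,
    map_zero] at h
  simp only [Matrix.add_apply, Matrix.smul_apply, Matrix.of_apply, Matrix.mul_apply,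
    Matrix.transpose_apply, Matrix.conjTranspose_apply, Matrix.one_apply, Matrix.map_apply,
    Matrix.neg_apply, star_trivial, smul_eq_mul, mul_neg, Finset.sum_neg_distrib]
  linarith
end

section
/- Let P : ℝ × ℝ → ℝ be a polynomial, regarded as the payoff function of a two-player zero-sum game in which each player's pure strategy set is [−1,1]. Then there exist Borel probability measures μ* and ν* on [−1,1] satisfying the saddle-point condition: for every Borel probability measure μ on [−1,1] and every Borel probability measure ν on [−1,1], ∫∫ P(x,y) dμ(x) dν*(y) ≤ ∫∫ P(x,y) dμ*(x) dν*(y) ≤ ∫∫ P(x,y) dμ*(x) dν(y). -/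
open MeasureTheory MvPolynomial

/-- The moment sequences of the Borel probability measures on `[−1,1]`. -/
def momentSet : Set (ℕ → ℝ) :=
  {u | ∃ μ : Measure ℝ, IsProbabilityMeasure μ ∧ (∀ᵐ x ∂μ, x ∈ Set.Icc (-1 : ℝ) 1) ∧
    ∀ n, u n = ∫ x, x ^ n ∂μ}

lemma integrable_pow_of_ae_mem_Icc {μ : Measure ℝ} [IsFiniteMeasure μ]
    (h : ∀ᵐ x ∂μ, x ∈ Set.Icc (-1 : ℝ) 1) (n : ℕ) : Integrable (fun x : ℝ => x ^ n) μ := by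
  refine Integrable.of_bound (by fun_prop) 1 ?_
  filter_upwards [h] with x hx
  rw [norm_pow]
  exact pow_le_one₀ (norm_nonneg _) (abs_le.2 hx)

lemma momentSet_eq_range : momentSet =
    Set.range fun (μ : ProbabilityMeasure (Set.Icc (-1 : ℝ) 1)) (n : ℕ) =>
      ∫ x, (x : ℝ) ^ n ∂(μ : Measure (Set.Icc (-1 : ℝ) 1)) := by
  have hemb : MeasurableEmbedding (Subtype.val : Set.Icc (-1 : ℝ) 1 → ℝ) :=
    .subtype_coe measurableSet_Icc
  ext u
  constructor
  · rintro ⟨μ, hμ, hs, hu⟩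
    have hmap : (μ.comap (Subtype.val : Set.Icc (-1 : ℝ) 1 → ℝ)).map Subtype.val = μ := by
      rw [hemb.map_comap, Subtype.range_coe, Measure.restrict_eq_self_of_ae_mem hs]
    have hprob : IsProbabilityMeasure (μ.comap (Subtype.val : Set.Icc (-1 : ℝ) 1 → ℝ)) := by
      rw [← Measure.isProbabilityMeasure_map_iff hemb.measurable.aemeasurable, hmap]
      exact hμ
    refine ⟨⟨_, hprob⟩, funext fun n => ?_⟩
    exact (hemb.integral_map fun x : ℝ => x ^ n).symm.trans (by
      rw [ProbabilityMeasure.coe_mk, hmap, hu])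
  · rintro ⟨μ, rfl⟩
    refine ⟨(μ : Measure (Set.Icc (-1 : ℝ) 1)).map Subtype.val,
      Measure.isProbabilityMeasure_map hemb.measurable.aemeasurable,
      hemb.ae_map_iff.2 (.of_forall Subtype.property), fun n => ?_⟩
    rw [hemb.integral_map]

lemma isCompact_momentSet : IsCompact momentSet := by
  rw [momentSet_eq_range]
  refine isCompact_range (continuous_pi fun n => ?_)
  exact ProbabilityMeasure.continuous_integral_boundedContinuousFunction
    (BoundedContinuousFunction.mkOfCompact
      ⟨fun x : Set.Icc (-1 : ℝ) 1 => (x : ℝ) ^ n, by fun_prop⟩)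

lemma convex_momentSet : Convex ℝ momentSet := by
  rintro u ⟨μ, hμ, hμs, hu⟩ v ⟨ν, hν, hνs, hv⟩ a b ha hb hab
  refine ⟨ENNReal.ofReal a • μ + ENNReal.ofReal b • ν, ⟨?_⟩, ?_, fun n => ?_⟩
  · simp [← ENNReal.ofReal_add ha hb, hab]
  · exact ae_add_measure_iff.2 ⟨Measure.ae_smul_measure hμs _, Measure.ae_smul_measure hνs _⟩
  · rw [integral_add_measure
      ((integrable_pow_of_ae_mem_Icc hμs n).smul_measure ENNReal.ofReal_ne_top)
      ((integrable_pow_of_ae_mem_Icc hνs n).smul_measure ENNReal.ofReal_ne_top)]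
    simp [hu, hv, ha, hb]

lemma momentSet_nonempty : momentSet.Nonempty :=
  ⟨_, Measure.dirac 0, inferInstance, by simp [ae_dirac_eq], fun _ => rfl⟩

/-- The payoff of a polynomial game as a bilinear function of the moments of the strategies. -/
def momentPayoff (P : MvPolynomial (Fin 2) ℝ) (v u : ℕ → ℝ) : ℝ :=
  ∑ d ∈ P.support, P.coeff d * (u (d 0) * v (d 1))

lemma integral_integral_eval_eq_momentPayoff (P : MvPolynomial (Fin 2) ℝ) {μ ν : Measure ℝ}
    [IsFiniteMeasure μ] [IsFiniteMeasure ν]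
    (hμ : ∀ᵐ x ∂μ, x ∈ Set.Icc (-1 : ℝ) 1) (hν : ∀ᵐ y ∂ν, y ∈ Set.Icc (-1 : ℝ) 1) :
    ∫ y : ℝ, ∫ x : ℝ, eval ![x, y] P ∂μ ∂ν =
      momentPayoff P (fun n => ∫ y, y ^ n ∂ν) (fun n => ∫ x, x ^ n ∂μ) := by
  have inner (y : ℝ) : ∫ x : ℝ, eval ![x, y] P ∂μ =
      ∑ d ∈ P.support, P.coeff d * ((∫ x, x ^ d 0 ∂μ) * y ^ d 1) := by
    simp only [eval_eq', Fin.prod_univ_two, Matrix.cons_val_zero, Matrix.cons_val_one]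
    rw [integral_finsetSum _ fun d _ =>
      ((integrable_pow_of_ae_mem_Icc hμ (d 0)).mul_const _).const_mul _]
    simp only [integral_const_mul, integral_mul_const]
  simp only [inner]
  rw [integral_finsetSum _ fun d _ =>
    ((integrable_pow_of_ae_mem_Icc hν (d 1)).const_mul _).const_mul _]
  simp only [integral_const_mul, momentPayoff]

lemma isLinearMap_momentPayoff_left (P : MvPolynomial (Fin 2) ℝ) (u : ℕ → ℝ) :
    IsLinearMap ℝ fun v => momentPayoff P v u where
  map_add v w := by
    simp only [momentPayoff, ← Finset.sum_add_distrib, Pi.add_apply, mul_add]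
  map_smul c v := by
    simp only [momentPayoff, Finset.mul_sum, Pi.smul_apply, smul_eq_mul]
    exact Finset.sum_congr rfl fun _ _ => by ring

lemma isLinearMap_momentPayoff_right (P : MvPolynomial (Fin 2) ℝ) (v : ℕ → ℝ) :
    IsLinearMap ℝ (momentPayoff P v) where
  map_add u w := by
    simp only [momentPayoff, ← Finset.sum_add_distrib, Pi.add_apply, mul_add, add_mul]
  map_smul c u := by
    simp only [momentPayoff, Finset.mul_sum, Pi.smul_apply, smul_eq_mul]
    exact Finset.sum_congr rfl fun _ _ => by ring

lemma exists_isSaddlePointOn_momentPayoff (P : MvPolynomial (Fin 2) ℝ) :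
    ∃ v ∈ momentSet, ∃ u ∈ momentSet,
      IsSaddlePointOn momentSet momentSet (momentPayoff P) v u := by
  refine Sion.exists_isSaddlePointOn momentSet_nonempty convex_momentSet isCompact_momentSet
    (fun u _ => (Continuous.lowerSemicontinuous ?_).lowerSemicontinuousOn _)
    (fun u _ => ((isLinearMap_momentPayoff_left P u).mk'.convexOn convex_momentSet).quasiconvexOn)
    convex_momentSet momentSet_nonempty isCompact_momentSet
    (fun v _ => (Continuous.upperSemicontinuous ?_).upperSemicontinuousOn _)
    (fun v _ => ((isLinearMap_momentPayoff_right P v).mk'.concaveOn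
      convex_momentSet).quasiconcaveOn)
  all_goals
    unfold momentPayoff
    fun_prop

/-- **Existence of Nash equilibria in two-player zero-sum polynomial games on
`[−1,1]`** (Dresher–Karlin–Shapley / Parrilo): there exist mixed strategies `μ*, ν*`
satisfying the saddle-point condition. -/
theorem polynomial_game_saddle_point (P : MvPolynomial (Fin 2) ℝ) :
    ∃ μstar νstar : Measure ℝ,
      IsProbabilityMeasure μstar ∧ (∀ᵐ x ∂μstar, x ∈ Set.Icc (-1 : ℝ) 1) ∧
      IsProbabilityMeasure νstar ∧ (∀ᵐ y ∂νstar, y ∈ Set.Icc (-1 : ℝ) 1) ∧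
      (∀ μ : Measure ℝ, IsProbabilityMeasure μ → (∀ᵐ x ∂μ, x ∈ Set.Icc (-1 : ℝ) 1) →
        (∫ y : ℝ, ∫ x : ℝ, eval ![x, y] P ∂μ ∂νstar)
          ≤ ∫ y : ℝ, ∫ x : ℝ, eval ![x, y] P ∂μstar ∂νstar) ∧
      (∀ ν : Measure ℝ, IsProbabilityMeasure ν → (∀ᵐ y ∂ν, y ∈ Set.Icc (-1 : ℝ) 1) →
        (∫ y : ℝ, ∫ x : ℝ, eval ![x, y] P ∂μstar ∂νstar)
          ≤ ∫ y : ℝ, ∫ x : ℝ, eval ![x, y] P ∂μstar ∂ν) := by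
  obtain ⟨_, ⟨νstar, hν, hνs, hv⟩, _, ⟨μstar, hμ, hμs, hu⟩, hsaddle⟩ :=
    exists_isSaddlePointOn_momentPayoff P
  obtain rfl := funext hv
  obtain rfl := funext hu
  refine ⟨μstar, νstar, hμ, hμs, hν, hνs, fun μ _ hs => ?_, fun ν _ hs => ?_⟩
  · rw [integral_integral_eval_eq_momentPayoff P hs hνs,
      integral_integral_eval_eq_momentPayoff P hμs hνs]
    exact hsaddle _ ⟨νstar, hν, hνs, fun _ => rfl⟩ _ ⟨μ, ‹_›, hs, fun _ => rfl⟩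
  · rw [integral_integral_eval_eq_momentPayoff P hμs hνs,
      integral_integral_eval_eq_momentPayoff P hμs hs]
    exact hsaddle _ ⟨ν, ‹_›, hs, fun _ => rfl⟩ _ ⟨μstar, hμ, hμs, fun _ => rfl⟩
end
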